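/- arXiv:1811.01212 — 2 statements merged into one kernel-verified Lean document; each statement's English description precedes it below -/
import Mathlib

section
/- The max–min problem max_{β ≥ 0} min_{τ ≥ σ} ψ_λ(β, τ) is achieved at a unique pair (β⋆, τ⋆), and (β⋆, τ⋆) is also the unique pair (β, τ) ∈ (0,∞)² satisfying the system τ² = σ² + (1/δ) E[(η(Θ + τZ; τλ/β) − Θ)²] and β = τ(1 − (1/δ) E[η′(Θ + τZ; τλ/β)]). Moreover, if δ ∈ (0,1) then 0 < β⋆ < λ/α_min(δ), where α_min(δ) is the unique positive solution of (1+α²)Φ(−α) − αφ(α) = δ/2. -/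
open MeasureTheory ProbabilityTheory
open scoped ENNReal NNReal

noncomputable section

/-- Standard Gaussian density φ. -/
def gphi (x : ℝ) : ℝ := Real.exp (-x ^ 2 / 2) / Real.sqrt (2 * Real.pi)

/-- Standard Gaussian CDF Φ. -/
def gPhi (x : ℝ) : ℝ := ∫ t in Set.Iic x, gphi t

/-- Soft thresholding η(x; b) = sign(x)(|x| − b)₊. -/
def eta (x b : ℝ) : ℝ := Real.sign x * max (|x| - b) 0

/-- Derivative in x of soft thresholding: η′(x; b) = 1_{|x| > b}. -/
def eta' (x b : ℝ) : ℝ := if b < |x| then 1 else 0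

/-- The ℓ_p ball F_p(ξ) = {x : (1/N) ∑ |xᵢ|^p ≤ ξ^p}. -/
def Fball (N : ℕ) (p ξ : ℝ) : Set (Fin N → ℝ) :=
  {x | (1 / (N : ℝ)) * ∑ i, |x i| ^ p ≤ ξ ^ p}

/-- Number of nonzero entries ‖x‖₀. -/
def l0 {N : ℕ} (x : Fin N → ℝ) : ℕ := (Finset.univ.filter fun i => x i ≠ 0).card

/-- The ℓ₀ ball F_0(s) = {x : ‖x‖₀ ≤ sN}. -/
def F0ball (N : ℕ) (s : ℝ) : Set (Fin N → ℝ) := {x | (l0 x : ℝ) ≤ s * N}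

/-- The critical sparsity s_max(δ). -/
def smax (δ : ℝ) : ℝ :=
  δ * sSup ((fun α : ℝ =>
      (1 - (2 / δ) * ((1 + α ^ 2) * gPhi (-α) - α * gphi α)) /
      (1 + α ^ 2 - 2 * ((1 + α ^ 2) * gPhi (-α) - α * gphi α))) '' Set.Ici 0)

/-- Empirical distribution of the entries of a vector. -/
def empDist {N : ℕ} (θ : Fin N → ℝ) : Measure ℝ :=
  ((N : ℝ≥0∞))⁻¹ • ∑ i : Fin N, Measure.dirac (θ i)

/-- Empirical distribution of pairs of entries of two vectors. -/
def empDist2 {N : ℕ} (u v : Fin N → ℝ) : Measure (ℝ × ℝ) :=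
  ((N : ℝ≥0∞))⁻¹ • ∑ i : Fin N, Measure.dirac (u i, v i)

/-- Squared order-2 Wasserstein distance between measures on ℝ². -/
def W2sq (μ ν : Measure (ℝ × ℝ)) : ℝ :=
  sInf {r : ℝ | ∃ γ : Measure ((ℝ × ℝ) × (ℝ × ℝ)),
    γ.map Prod.fst = μ ∧ γ.map Prod.snd = ν ∧
    r = ∫ q, ((q.1.1 - q.2.1) ^ 2 + (q.1.2 - q.2.2) ^ 2) ∂γ}

/-- Order-2 Wasserstein distance. -/
def W2 (μ ν : Measure (ℝ × ℝ)) : ℝ := Real.sqrt (W2sq μ ν)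

/-- Standard Gaussian measure on ℝ. -/
def stdG : Measure ℝ := gaussianReal 0 1

/-- The state-evolution fixed point equations (for (Θ,Z) ∼ μ ⊗ N(0,1)),
together with positivity of (β, τ). -/
def StateEvo (δ σ : ℝ) (μ : Measure ℝ) (lam β τ : ℝ) : Prop :=
  0 < β ∧ 0 < τ ∧
  τ ^ 2 = σ ^ 2 + (1 / δ) *
    ∫ q : ℝ × ℝ, (eta (q.1 + τ * q.2) (τ * lam / β) - q.1) ^ 2 ∂(μ.prod stdG) ∧
  β = τ * (1 - (1 / δ) *
    ∫ q : ℝ × ℝ, eta' (q.1 + τ * q.2) (τ * lam / β) ∂(μ.prod stdG))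

/-- s⋆ = P(|Θ + τZ| ≥ ατ) for (Θ,Z) ∼ μ ⊗ N(0,1). -/
def sStar (μ : Measure ℝ) (τ α : ℝ) : ℝ :=
  ((μ.prod stdG) {q : ℝ × ℝ | α * τ ≤ |q.1 + τ * q.2|}).toReal

/-- The limit law μ⋆: law of (η(Θ + τZ; ατ), Θ) for (Θ,Z) ∼ μ ⊗ N(0,1). -/
def muStar (μ : Measure ℝ) (τ α : ℝ) : Measure (ℝ × ℝ) :=
  (μ.prod stdG).map (fun q => (eta (q.1 + τ * q.2) (α * τ), q.1))

/-- The limit law for the debiased Lasso: law of (Θ + τZ, Θ). -/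
def muStarD (μ : Measure ℝ) (τ : ℝ) : Measure (ℝ × ℝ) :=
  (μ.prod stdG).map (fun q => (q.1 + τ * q.2, q.1))

/-- Law of the design matrix: i.i.d. N(0, 1/n) entries. -/
def PX (n N : ℕ) : Measure (Fin n → Fin N → ℝ) :=
  Measure.pi fun _ => Measure.pi fun _ => gaussianReal 0 ((n : ℝ≥0))⁻¹

/-- Law of the noise: i.i.d. standard Gaussian entries. -/
def Pz (n : ℕ) : Measure (Fin n → ℝ) :=
  Measure.pi fun _ => gaussianReal 0 1

/-- Joint law of (X, z). -/
def Pmodel (n N : ℕ) : Measure ((Fin n → Fin N → ℝ) × (Fin n → ℝ)) :=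
  (PX n N).prod (Pz n)

/-- The response y = Xθ⋆ + σz. -/
def yvec {n N : ℕ} (σ : ℝ) (θstar : Fin N → ℝ) (X : Fin n → Fin N → ℝ)
    (z : Fin n → ℝ) : Fin n → ℝ :=
  fun i => (∑ j, X i j * θstar j) + σ * z i

/-- The Lasso cost (1/(2n))‖y − Xθ‖² + (λ/n)‖θ‖₁. -/
def lassoCost {n N : ℕ} (X : Fin n → Fin N → ℝ) (y : Fin n → ℝ) (lam : ℝ)
    (θ : Fin N → ℝ) : ℝ :=
  (1 / (2 * (n : ℝ))) * ∑ i, (y i - ∑ j, X i j * θ j) ^ 2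
    + (lam / (n : ℝ)) * ∑ j, |θ j|

/-- The uniformity class: D is either an ℓ_p ball F_p(ξ) or an ℓ₀ ball F_0(s) with
s below the critical sparsity, with the corresponding exponent q. -/
def DFamSpec (δ : ℝ) (Dfam : (M : ℕ) → Set (Fin M → ℝ)) (q : ℝ) : Prop :=
  (∃ p ξ : ℝ, 0 < p ∧ 0 < ξ ∧ (∀ M, Dfam M = Fball M p ξ) ∧ q = max (1 / p - 1) 0) ∨
  (∃ s : ℝ, 0 ≤ s ∧ s < smax δ ∧ (∀ M, Dfam M = F0ball M s) ∧ q = 0)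

/-- The inner scalar minimization min_w { w²β/(2τ) − βzw + λ|w+θ| − λ|θ| }. -/
def scalarInner (lam β τ θ z : ℝ) : ℝ :=
  sInf (Set.range fun w : ℝ =>
    w ^ 2 / (2 * τ) * β - β * z * w + lam * |w + θ| - lam * |θ|)

/-- The scalar objective ψ_λ(β, τ). -/
def psiFn (δ σ : ℝ) (P0 : Measure ℝ) (lam β τ : ℝ) : ℝ :=
  (σ ^ 2 / τ + τ) * β / 2 - β ^ 2 / 2 +
    (1 / δ) * ∫ q : ℝ × ℝ, scalarInner lam β τ q.1 q.2 ∂(P0.prod stdG)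

/-- (β, τ) is a max–min point of f over β ∈ [0,∞), τ ∈ [σ,∞): τ minimizes
f(β, ·) over [σ, ∞) and β maximizes β′ ↦ inf_{τ′ ≥ σ} f(β′, τ′) over [0, ∞). -/
def IsMaxMin (f : ℝ → ℝ → ℝ) (σ β τ : ℝ) : Prop :=
  0 ≤ β ∧ σ ≤ τ ∧ IsMinOn (f β) (Set.Ici σ) τ ∧
  ∀ β' ∈ Set.Ici (0 : ℝ), ∀ ε > (0 : ℝ), ∃ τ' ∈ Set.Ici σ, f β' τ' < f β τ + ε

open Filter Topology

instance : IsProbabilityMeasure stdG := by unfold stdG; infer_instance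

/-! ### The clipped map -/

/-- The projection of `-t` onto the interval `[z - a, z + a]` (for `0 ≤ a`). -/
def clip (t z a : ℝ) : ℝ := max (z - a) (min (-t) (z + a))

lemma continuous_clip : Continuous fun p : ℝ × ℝ × ℝ => clip p.1 p.2.1 p.2.2 := by
  unfold clip; fun_prop

@[fun_prop]
lemma Continuous.clip {X : Type*} [TopologicalSpace X] {f g h : X → ℝ} (hf : Continuous f)
    (hg : Continuous g) (hh : Continuous h) : Continuous fun x => clip (f x) (g x) (h x) :=
  continuous_clip.comp (hf.prodMk (hg.prodMk hh))

lemma abs_clip_le (t z a : ℝ) : |clip t z a| ≤ |z| + |a| := by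
  unfold clip
  rcases max_cases (z - a) (min (-t) (z + a)) with h | h <;>
  rcases min_cases (-t) (z + a) with h' | h' <;>
  rw [abs_le] <;> constructor <;>
  linarith [le_abs_self z, neg_abs_le z, le_abs_self a, neg_abs_le a]

lemma abs_sub_clip_le {a : ℝ} (ha : 0 ≤ a) (t z : ℝ) : |z - clip t z a| ≤ a := by
  unfold clip
  rcases max_cases (z - a) (min (-t) (z + a)) with h | h <;>
  rcases min_cases (-t) (z + a) with h' | h' <;>
  rw [abs_le] <;> constructor <;> linarith

lemma sub_clip_mul {a : ℝ} (ha : 0 ≤ a) (t z : ℝ) :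
    (z - clip t z a) * (clip t z a + t) = a * |clip t z a + t| := by
  unfold clip
  rcases max_cases (z - a) (min (-t) (z + a)) with h | h <;>
  rcases min_cases (-t) (z + a) with h' | h' <;> rw [h.1]
  · rw [abs_of_nonneg (by linarith)]; ring
  · obtain rfl : a = 0 := by linarith
    simp
  · rw [h'.1]; simp
  · rw [h'.1, abs_of_nonpos (by linarith)]; ring

lemma clip_sq_mono {a s s' : ℝ} (ha : 0 ≤ a) (hs : 0 ≤ s) (hss : s ≤ s') (θ z : ℝ) :
    clip (s * θ) z a ^ 2 ≤ clip (s' * θ) z a ^ 2 := by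
  rcases le_total 0 θ with h0 | h0
  · have h1 : 0 ≤ s * θ := by positivity
    have h2 : s * θ ≤ s' * θ := by gcongr
    unfold clip
    generalize s * θ = t at *
    generalize s' * θ = t' at *
    rcases max_cases (z - a) (min (-t) (z + a)) with h | h <;>
    rcases min_cases (-t) (z + a) with h' | h' <;>
    rcases max_cases (z - a) (min (-t') (z + a)) with k | k <;>
    rcases min_cases (-t') (z + a) with k' | k' <;> rw [h.1, k.1] <;>
    nlinarith
  · have h1 : s * θ ≤ 0 := mul_nonpos_of_nonneg_of_nonpos hs h0
    have h2 : s' * θ ≤ s * θ := mul_le_mul_of_nonpos_right hss h0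
    unfold clip
    generalize s * θ = t at *
    generalize s' * θ = t' at *
    rcases max_cases (z - a) (min (-t) (z + a)) with h | h <;>
    rcases min_cases (-t) (z + a) with h' | h' <;>
    rcases max_cases (z - a) (min (-t') (z + a)) with k | k <;>
    rcases min_cases (-t') (z + a) with k' | k' <;> rw [h.1, k.1] <;>
    nlinarith

lemma clip_zero_sq {a : ℝ} (ha : 0 ≤ a) (z : ℝ) : clip 0 z a ^ 2 = max (|z| - a) 0 ^ 2 := by
  unfold clip
  rcases max_cases (z - a) (min (-0) (z + a)) with h | h <;>
  rcases min_cases (-0) (z + a) with h' | h' <;>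
  rcases max_cases (|z| - a) 0 with k | k <;>
  rcases abs_cases z with l | l <;> rw [h.1, k.1] <;>
  nlinarith

lemma eta_mul_sub {τ a : ℝ} (hτ : 0 < τ) (ha : 0 ≤ a) (θ z : ℝ) :
    eta (θ + τ * z) (τ * a) - θ = τ * clip (τ⁻¹ * θ) z a := by
  obtain ⟨t, rfl⟩ : ∃ t, θ = τ * t := ⟨τ⁻¹ * θ, by field_simp⟩
  have h1 : τ⁻¹ * (τ * t) = t := by field_simp
  have hs : Real.sign (τ * t + τ * z) = Real.sign (t + z) := by
    rw [← mul_add]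
    rcases lt_trichotomy (t + z) 0 with h | h | h
    · rw [Real.sign_of_neg h, Real.sign_of_neg (by nlinarith)]
    · rw [h, mul_zero]
    · rw [Real.sign_of_pos h, Real.sign_of_pos (by positivity)]
  have hm : max (|τ * t + τ * z| - τ * a) 0 = τ * max (|t + z| - a) 0 := by
    rw [← mul_add, abs_mul, abs_of_pos hτ, ← mul_sub, mul_max_of_nonneg _ _ hτ.le, mul_zero]
  have key : Real.sign (t + z) * max (|t + z| - a) 0 - t = clip t z a := by
    unfold clip
    rcases lt_trichotomy (t + z) 0 with h | h | h
    · rw [Real.sign_of_neg h, abs_of_neg h]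
      rcases max_cases (-(t + z) - a) 0 with k | k
      · rw [k.1, min_eq_right (by linarith), max_eq_right (by linarith)]; ring
      · rw [k.1, min_eq_left (by linarith), max_eq_right (by linarith)]; ring
    · rw [h, Real.sign_zero, zero_mul, min_eq_left (by linarith), max_eq_right (by linarith)]
      ring
    · rw [Real.sign_of_pos h, abs_of_pos h]
      rcases max_cases ((t + z) - a) 0 with k | k
      · rw [k.1, min_eq_left (by linarith), max_eq_left (by linarith)]; ring
      · rw [k.1, min_eq_left (by linarith), max_eq_right (by linarith)]; ring
  rw [eta, hs, hm, h1, ← key]; ring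

lemma eta'_mul {τ a : ℝ} (hτ : 0 < τ) (θ z : ℝ) :
    eta' (θ + τ * z) (τ * a) = eta' (τ⁻¹ * θ + z) a := by
  have : |θ + τ * z| = τ * |τ⁻¹ * θ + z| := by
    rw [← abs_of_pos hτ, ← abs_mul, abs_of_pos hτ]; congr 1; field_simp
  simp only [eta', this, mul_lt_mul_iff_right₀ hτ]

/-! ### The scalar minimization -/

/-- The objective of the scalar minimization. -/
def innerObj (lam β τ θ z w : ℝ) : ℝ :=
  w ^ 2 / (2 * τ) * β - β * z * w + lam * |w + θ| - lam * |θ|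

lemma innerObj_ge {lam β τ : ℝ} (hlam : 0 ≤ lam) (hβ : 0 < β) (hτ : 0 < τ) {τ' : ℝ}
    (hτ' : 0 < τ') (θ z w : ℝ) :
    innerObj lam β τ θ z (τ * clip (τ⁻¹ * θ) z (lam / β))
      - (τ' - τ) * (β / 2 * clip (τ⁻¹ * θ) z (lam / β) ^ 2) ≤ innerObj lam β τ' θ z w := by
  obtain ⟨t, rfl⟩ : ∃ t, θ = τ * t := ⟨τ⁻¹ * θ, by field_simp⟩
  have h1 : τ⁻¹ * (τ * t) = t := by field_simp
  rw [h1]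
  have ha : 0 ≤ lam / β := by positivity
  have e1 := sub_clip_mul ha t z
  have e2 := abs_sub_clip_le ha t z
  set c := clip t z (lam / β)
  have hl : β * (lam / β) = lam := by field_simp
  have e3 : β * (z - c) * (w + τ * t) ≤ lam * |w + τ * t| := by
    calc _ ≤ |β * (z - c) * (w + τ * t)| := le_abs_self _
      _ = β * |z - c| * |w + τ * t| := by rw [abs_mul, abs_mul, abs_of_pos hβ]
      _ ≤ β * (lam / β) * |w + τ * t| := by gcongr
      _ = _ := by rw [hl]
  have e4 : lam * |τ * c + τ * t| = β * τ * ((z - c) * (c + t)) := by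
    rw [e1, ← mul_add, abs_mul, abs_of_pos hτ]; linear_combination (-τ * |c + t|) * hl
  unfold innerObj
  rw [e4]
  have e5 : 0 ≤ β / (2 * τ') * (w - c * τ') ^ 2 := by positivity
  have e6 : β / (2 * τ') * (w - c * τ') ^ 2
      = w ^ 2 / (2 * τ') * β - β * w * c + β * c ^ 2 * τ' / 2 := by field_simp; ring
  have e7 : (τ * c) ^ 2 / (2 * τ) * β = τ * c ^ 2 * β / 2 := by field_simp
  rw [e7]
  nlinarith

lemma scalarInner_eq {lam β τ : ℝ} (hlam : 0 ≤ lam) (hβ : 0 < β) (hτ : 0 < τ) (θ z : ℝ) :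
    scalarInner lam β τ θ z
      = innerObj lam β τ θ z (τ * clip (τ⁻¹ * θ) z (lam / β)) := by
  refine IsLeast.csInf_eq ⟨⟨_, rfl⟩, ?_⟩
  rintro _ ⟨w, rfl⟩
  change _ ≤ innerObj lam β τ θ z w
  simpa using innerObj_ge hlam hβ hτ hτ θ z w

lemma scalarInner_zero {lam : ℝ} (hlam : 0 ≤ lam) (τ θ z : ℝ) :
    scalarInner lam 0 τ θ z = -(lam * |θ|) := by
  refine IsLeast.csInf_eq ⟨⟨-θ, by simp⟩, ?_⟩
  rintro _ ⟨w, rfl⟩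
  have : 0 ≤ lam * |w + θ| := by positivity
  simp only
  linarith

lemma scalarInner_le {lam β τ : ℝ} (hlam : 0 ≤ lam) (hβ : 0 ≤ β) (hτ : 0 < τ) (θ z w : ℝ) :
    scalarInner lam β τ θ z ≤ innerObj lam β τ θ z w := by
  rcases hβ.eq_or_lt with rfl | hβ
  · rw [scalarInner_zero hlam]
    have : 0 ≤ lam * |w + θ| := by positivity
    unfold innerObj
    linarith
  · rw [scalarInner_eq hlam hβ hτ]
    simpa using innerObj_ge hlam hβ hτ hτ θ z w
/-! ### Gaussian integrals -/

lemma stdG_def : stdG = gaussianReal 0 1 := rfl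

lemma gphi_eq (x : ℝ) : gphi x = gaussianPDFReal 0 1 x := by
  simp [gphi, gaussianPDFReal]; ring_nf

lemma gphi_pos (x : ℝ) : 0 < gphi x := by
  rw [gphi_eq]; exact gaussianPDFReal_pos _ _ _ one_ne_zero

lemma hasDerivAt_gphi (x : ℝ) : HasDerivAt gphi (-x * gphi x) x := by
  have h : HasDerivAt (fun x : ℝ => -x ^ 2 / 2) (-x) x := by
    have := ((hasDerivAt_pow 2 x).neg).div_const 2
    convert! this using 1
    simp; ring
  have := h.exp.div_const (Real.sqrt (2 * Real.pi))
  convert! this using 1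
  simp only [gphi]; ring

lemma continuous_gphi : Continuous gphi := by unfold gphi; fun_prop

lemma integral_stdG (f : ℝ → ℝ) : ∫ x, f x ∂stdG = ∫ x, gphi x * f x := by
  rw [stdG_def, integral_gaussianReal_eq_integral_smul one_ne_zero]
  simp [gphi_eq]

lemma integrable_stdG_iff (f : ℝ → ℝ) :
    Integrable f stdG ↔ Integrable (fun x => gphi x * f x) := by
  rw [stdG_def, gaussianReal_of_var_ne_zero _ one_ne_zero,
    integrable_withDensity_iff_integrable_smul' (measurable_gaussianPDF _ _)
      (ae_of_all _ fun _ => gaussianPDF_lt_top)]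
  simp [gphi_eq, toReal_gaussianPDF]

lemma integrable_pow_stdG (n : ℕ) : Integrable (fun x : ℝ => |x| ^ n) stdG := by
  rcases Nat.eq_zero_or_pos n with rfl | hn
  · simp
  have := (memLp_id_gaussianReal' (μ := 0) (v := 1) n (by simp)).integrable_norm_pow hn.ne'
  simpa [stdG_def] using this

lemma integral_sq_stdG : ∫ x, x ^ 2 ∂stdG = 1 := by
  have h := variance_fun_id_gaussianReal (μ := 0) (v := 1)
  rw [variance_eq_integral (by fun_prop)] at h
  simpa [stdG_def, integral_id_gaussianReal] using h

lemma tendsto_abs_add_mul_gphi (a : ℝ) :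
    Tendsto (fun x => (|x| + a) * gphi x) (cocompact ℝ) (𝓝 0) := by
  have h1 := tendsto_rpow_abs_mul_exp_neg_mul_sq_cocompact (a := 1 / 2) (by norm_num) 1
  have h0 := tendsto_rpow_abs_mul_exp_neg_mul_sq_cocompact (a := 1 / 2) (by norm_num) 0
  have := (h1.add (h0.const_mul a)).mul_const (Real.sqrt (2 * Real.pi))⁻¹
  simp only [mul_zero, add_zero, zero_mul] at this
  refine this.congr fun x => ?_
  simp only [Real.rpow_one, Real.rpow_zero, gphi]
  rw [show -(1 / 2) * x ^ 2 = -x ^ 2 / 2 by ring]; ring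

lemma integrable_of_le_sq {f : ℝ → ℝ} (hf : AEStronglyMeasurable f stdG) (C D : ℝ)
    (h : ∀ x, |f x| ≤ C + D * |x| ^ 2) : Integrable f stdG :=
  Integrable.mono' ((integrable_const C).add ((integrable_pow_stdG 2).const_mul D)) hf
    (ae_of_all _ h)

lemma measurable_eta' : Measurable fun p : ℝ × ℝ => eta' p.1 p.2 := by
  unfold eta'
  exact Measurable.ite (measurableSet_lt (by fun_prop) (by fun_prop)) measurable_const
    measurable_const

lemma eta'_nonneg (x b : ℝ) : 0 ≤ eta' x b := by unfold eta'; split_ifs <;> norm_num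

lemma eta'_le_one (x b : ℝ) : eta' x b ≤ 1 := by unfold eta'; split_ifs <;> norm_num

lemma hasDerivAt_clip {a : ℝ} (ha : 0 ≤ a) (t : ℝ) {z : ℝ} (h1 : z ≠ -t - a) (h2 : z ≠ -t + a) :
    HasDerivAt (fun z => clip t z a) (eta' (t + z) a) z := by
  unfold eta' clip
  rcases lt_or_gt_of_ne h1 with h | h
  · rw [if_pos (by rw [abs_of_neg (by linarith)]; linarith)]
    refine ((hasDerivAt_id z).add_const a).congr_of_eventuallyEq ?_
    filter_upwards [Iio_mem_nhds h] with y hy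
    simp only [Set.mem_Iio] at hy
    rw [min_eq_right (by linarith), max_eq_right (by linarith)]; rfl
  rcases lt_or_gt_of_ne h2 with h' | h'
  · rw [if_neg (by rw [not_lt, abs_le]; constructor <;> linarith)]
    refine (hasDerivAt_const z (-t)).congr_of_eventuallyEq ?_
    filter_upwards [Ioo_mem_nhds h h'] with y hy
    simp only [Set.mem_Ioo] at hy
    rw [min_eq_left (by linarith), max_eq_right (by linarith)]
  · rw [if_pos (by rw [abs_of_pos (by linarith)]; linarith)]
    refine ((hasDerivAt_id z).sub_const a).congr_of_eventuallyEq ?_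
    filter_upwards [Ioi_mem_nhds h'] with y hy
    simp only [Set.mem_Ioi] at hy
    rw [min_eq_left (by linarith), max_eq_left (by linarith)]; rfl

lemma integrable_mul_clip_stdG (t a : ℝ) : Integrable (fun z => z * clip t z a) stdG := by
  refine integrable_of_le_sq (by fun_prop) (|a| ^ 2) 2 fun z => ?_
  rw [abs_mul]
  nlinarith [abs_clip_le t z a, abs_nonneg z, abs_nonneg a, sq_nonneg (|z| - |a|),
    mul_le_mul_of_nonneg_left (abs_clip_le t z a) (abs_nonneg z)]

lemma integrable_eta'_stdG (t a : ℝ) : Integrable (fun z => eta' (t + z) a) stdG := by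
  refine integrable_of_le_sq ?_ 1 0 fun z => ?_
  · exact (measurable_eta'.comp (by fun_prop : Measurable fun z : ℝ => (t + z, a))).aestronglyMeasurable
  · rw [abs_of_nonneg (eta'_nonneg _ _)]; linarith [eta'_le_one (t + z) a]

/-- Gaussian integration by parts for the clipped map. -/
lemma integral_mul_clip_stdG {a : ℝ} (ha : 0 ≤ a) (t : ℝ) :
    ∫ z, z * clip t z a ∂stdG = ∫ z, eta' (t + z) a ∂stdG := by
  have hint := (integrable_eta'_stdG t a).sub (integrable_mul_clip_stdG t a)
  have hint' := (integrable_stdG_iff _).1 hint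
  rw [eq_comm, ← sub_eq_zero, ← integral_sub (integrable_eta'_stdG t a)
    (integrable_mul_clip_stdG t a), integral_stdG]
  have hlim := intervalIntegral_tendsto_integral hint' tendsto_neg_atTop_atBot tendsto_id
  refine tendsto_nhds_unique hlim ?_
  have hF : Tendsto (fun z => clip t z a * gphi z) (cocompact ℝ) (𝓝 0) := by
    refine squeeze_zero_norm (fun z => ?_) (tendsto_abs_add_mul_gphi |a|)
    rw [norm_mul, Real.norm_eq_abs, Real.norm_eq_abs, abs_of_pos (gphi_pos z)]
    exact mul_le_mul_of_nonneg_right (abs_clip_le t z a) (gphi_pos z).le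
  have hF1 := hF.mono_left atTop_le_cocompact
  have hF2 := (hF.mono_left atBot_le_cocompact).comp tendsto_neg_atTop_atBot
  have hsub := hF1.sub hF2
  rw [sub_zero] at hsub
  refine hsub.congr fun x => ?_
  symm
  refine MeasureTheory.integral_eq_of_hasDerivAt_off_countable (s := {-t - a, -t + a})
    (fun z => clip t z a * gphi z) _ (Set.to_countable _) ?_ ?_ ?_
  · have := continuous_gphi
    fun_prop
  · intro z hz
    have hz' : z ≠ -t - a ∧ z ≠ -t + a := by simpa using hz.2
    convert! (hasDerivAt_clip ha t hz'.1 hz'.2).mul (hasDerivAt_gphi z) using 1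
    simp only [Pi.sub_apply]
    ring
  · exact hint'.intervalIntegrable

lemma integral_clip_zero_sq {a : ℝ} (ha : 0 ≤ a) :
    ∫ z, clip 0 z a ^ 2 ∂stdG = 2 * ((1 + a ^ 2) * gPhi (-a) - a * gphi a) := by
  have hsymm : ∀ z, gphi z * clip 0 z a ^ 2 = (fun x => gphi x * max (x - a) 0 ^ 2) |z| := by
    intro z
    simp only [clip_zero_sq ha, gphi, sq_abs]
  have hφ : IntegrableOn gphi (Set.Ioi a) := by
    have := (integrable_stdG_iff fun _ => 1).1 (integrable_const _)
    simpa using this.integrableOn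
  have hpoly : IntegrableOn (fun x => (x ^ 2 - 1 - 2 * a * x) * gphi x) (Set.Ioi a) := by
    have h : Integrable (fun x : ℝ => x ^ 2 - 1 - 2 * a * x) stdG := by
      refine integrable_of_le_sq (by fun_prop) (1 + |a| ^ 2) 2 fun x => ?_
      have := abs_nonneg x
      rw [abs_le]; constructor <;>
        nlinarith [sq_abs x, sq_abs a, sq_nonneg (x - a), sq_nonneg (x + a)]
    have := ((integrable_stdG_iff _).1 h).integrableOn (s := Set.Ioi a)
    simpa only [mul_comm] using this
  have hder : ∫ x in Set.Ioi a, (x ^ 2 - 1 - 2 * a * x) * gphi x = 0 - -((a - 2 * a) * gphi a) := by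
    refine integral_Ioi_of_hasDerivAt_of_tendsto' (f := fun x => -((x - 2 * a) * gphi x))
      (fun x _ => ?_) hpoly ?_
    · convert! (((hasDerivAt_id x).sub_const (2 * a)).mul (hasDerivAt_gphi x)).neg using 1
      simp only [id]; ring
    · refine squeeze_zero_norm (fun z => ?_)
        ((tendsto_abs_add_mul_gphi (2 * |a|)).mono_left atTop_le_cocompact)
      rw [norm_neg, norm_mul, Real.norm_eq_abs, Real.norm_eq_abs, abs_of_pos (gphi_pos z)]
      refine mul_le_mul_of_nonneg_right ?_ (gphi_pos z).le
      calc |z - 2 * a| ≤ |z| + |2 * a| := abs_sub _ _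
        _ = _ := by rw [abs_mul]; norm_num
  have hPhi : ∫ x in Set.Ioi a, gphi x = gPhi (-a) := by
    unfold gPhi
    rw [← integral_comp_neg_Ioi]
    simp [gphi]
  rw [integral_stdG]
  simp_rw [hsymm]
  rw [integral_comp_abs (f := fun x => gphi x * max (x - a) 0 ^ 2)]
  congr 1
  have hsplit : ∫ x in Set.Ioi 0, gphi x * max (x - a) 0 ^ 2
      = ∫ x in Set.Ioi a, gphi x * max (x - a) 0 ^ 2 := by
    refine setIntegral_eq_of_subset_of_forall_sdiff_eq_zero measurableSet_Ioi
      (Set.Ioi_subset_Ioi ha) fun x hx => ?_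
    rw [max_eq_right (by simpa using hx.2)]; simp
  rw [hsplit, setIntegral_congr_fun (g := fun x => (1 + a ^ 2) * gphi x
    + (x ^ 2 - 1 - 2 * a * x) * gphi x) measurableSet_Ioi]
  · rw [integral_add (hφ.const_mul _) hpoly, integral_const_mul, hPhi, hder]; ring
  · intro x hx
    simp only [Set.mem_Ioi] at hx
    simp only
    rw [max_eq_left (by linarith)]; ring
/-! ### Averages over the product measure -/

/-- `E[x²]` where `x` is the projection of `-sΘ` onto `[Z - a, Z + a]`. -/
def avgSq (μ : Measure ℝ) (a s : ℝ) : ℝ :=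
  ∫ q : ℝ × ℝ, clip (s * q.1) q.2 a ^ 2 ∂(μ.prod stdG)

/-- `E[Z x]` where `x` is the projection of `-sΘ` onto `[Z - a, Z + a]`. -/
def avgMul (μ : Measure ℝ) (a s : ℝ) : ℝ :=
  ∫ q : ℝ × ℝ, q.2 * clip (s * q.1) q.2 a ∂(μ.prod stdG)

lemma avgSq_nonneg (μ : Measure ℝ) (a s : ℝ) : 0 ≤ avgSq μ a s :=
  integral_nonneg fun _ => sq_nonneg _

section Averages

variable {μ : Measure ℝ} [IsProbabilityMeasure μ]

lemma integrable_prod_bound (C D : ℝ) :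
    Integrable (fun q : ℝ × ℝ => C + D * |q.2| ^ 2) (μ.prod stdG) :=
  (integrable_const C).add (((integrable_pow_stdG 2).comp_snd μ).const_mul D)

lemma integrable_prod_of_le_sq {f : ℝ × ℝ → ℝ} (hf : Measurable f) (C D : ℝ)
    (h : ∀ q, |f q| ≤ C + D * |q.2| ^ 2) : Integrable f (μ.prod stdG) :=
  (integrable_prod_bound C D).mono' hf.aestronglyMeasurable (ae_of_all _ h)

lemma abs_mul_clip_le (t z a : ℝ) : |z * clip t z a| ≤ |a| ^ 2 + 2 * |z| ^ 2 := by
  rw [abs_mul]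
  nlinarith [abs_clip_le t z a, abs_nonneg z, abs_nonneg a, sq_nonneg (|z| - |a|),
    mul_le_mul_of_nonneg_left (abs_clip_le t z a) (abs_nonneg z)]

lemma abs_clip_sq_le (t z a : ℝ) : |clip t z a ^ 2| ≤ 2 * |a| ^ 2 + 2 * |z| ^ 2 := by
  rw [abs_pow]
  nlinarith [abs_clip_le t z a, abs_nonneg z, abs_nonneg a, sq_nonneg (|z| - |a|),
    abs_nonneg (clip t z a)]

lemma integrable_clip_sq (a s : ℝ) :
    Integrable (fun q : ℝ × ℝ => clip (s * q.1) q.2 a ^ 2) (μ.prod stdG) :=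
  integrable_prod_of_le_sq (Continuous.measurable (by fun_prop)) _ _ fun _ => abs_clip_sq_le _ _ _

lemma integrable_mul_clip (a s : ℝ) :
    Integrable (fun q : ℝ × ℝ => q.2 * clip (s * q.1) q.2 a) (μ.prod stdG) :=
  integrable_prod_of_le_sq (Continuous.measurable (by fun_prop)) _ _ fun _ => abs_mul_clip_le _ _ _

lemma integrable_snd_sq : Integrable (fun q : ℝ × ℝ => q.2 ^ 2) (μ.prod stdG) :=
  integrable_prod_of_le_sq (by fun_prop) 0 1 fun q => by simp

lemma integrable_eta' (a s : ℝ) :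
    Integrable (fun q : ℝ × ℝ => eta' (s * q.1 + q.2) a) (μ.prod stdG) := by
  refine integrable_prod_of_le_sq ?_ 1 0 fun q => ?_
  · exact measurable_eta'.comp (by fun_prop : Measurable fun q : ℝ × ℝ => (s * q.1 + q.2, a))
  · rw [abs_of_nonneg (eta'_nonneg _ _)]; linarith [eta'_le_one (s * q.1 + q.2) a]

lemma integral_snd (f : ℝ → ℝ) : ∫ q : ℝ × ℝ, f q.2 ∂(μ.prod stdG) = ∫ z, f z ∂stdG := by
  rw [integral_fun_snd]; simp

lemma continuous_avgSq : Continuous fun p : ℝ × ℝ => avgSq μ p.1 p.2 := by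
  rw [continuous_iff_continuousAt]
  intro p₀
  have hn : ∀ᶠ p : ℝ × ℝ in 𝓝 p₀, |p.1| < |p₀.1| + 1 :=
    (continuous_fst.abs).continuousAt.eventually_lt continuousAt_const (by linarith)
  refine continuousAt_of_dominated
    (bound := fun q => 2 * (|p₀.1| + 1) ^ 2 + 2 * |q.2| ^ 2) ?_ ?_ (integrable_prod_bound _ _) ?_
  · exact Eventually.of_forall fun p => (integrable_clip_sq _ _).aestronglyMeasurable
  · filter_upwards [hn] with p hp
    refine ae_of_all _ fun q => (abs_clip_sq_le _ _ _).trans ?_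
    gcongr
  · exact ae_of_all _ fun q => Continuous.continuousAt (by fun_prop)

lemma continuous_avgMul : Continuous fun p : ℝ × ℝ => avgMul μ p.1 p.2 := by
  rw [continuous_iff_continuousAt]
  intro p₀
  have hn : ∀ᶠ p : ℝ × ℝ in 𝓝 p₀, |p.1| < |p₀.1| + 1 :=
    (continuous_fst.abs).continuousAt.eventually_lt continuousAt_const (by linarith)
  refine continuousAt_of_dominated
    (bound := fun q => (|p₀.1| + 1) ^ 2 + 2 * |q.2| ^ 2) ?_ ?_ (integrable_prod_bound _ _) ?_
  · exact Eventually.of_forall fun p => (integrable_mul_clip _ _).aestronglyMeasurable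
  · filter_upwards [hn] with p hp
    refine ae_of_all _ fun q => (abs_mul_clip_le _ _ _).trans ?_
    gcongr
  · exact ae_of_all _ fun q => Continuous.continuousAt (by fun_prop)

lemma avgSq_mono {a s s' : ℝ} (ha : 0 ≤ a) (hs : 0 ≤ s) (hss : s ≤ s') :
    avgSq μ a s ≤ avgSq μ a s' :=
  integral_mono (integrable_clip_sq _ _) (integrable_clip_sq _ _)
    fun q => clip_sq_mono ha hs hss q.1 q.2

lemma avgSq_zero (a : ℝ) : avgSq μ a 0 = ∫ z, clip 0 z a ^ 2 ∂stdG := by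
  simp only [avgSq, zero_mul]
  exact integral_snd fun z => clip 0 z a ^ 2

lemma avgMul_eq {a : ℝ} (ha : 0 ≤ a) (s : ℝ) :
    avgMul μ a s = ∫ q : ℝ × ℝ, eta' (s * q.1 + q.2) a ∂(μ.prod stdG) := by
  rw [avgMul, integral_prod _ (integrable_mul_clip _ _), integral_prod _ (integrable_eta' _ _)]
  simp only [integral_mul_clip_stdG ha]

lemma stateEvo_iff {δ σ lam β τ : ℝ} (hδ : 0 < δ) (hlam : 0 < lam) :
    StateEvo δ σ μ lam β τ ↔ 0 < β ∧ 0 < τ ∧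
      δ * σ ^ 2 * τ⁻¹ ^ 2 + avgSq μ (lam / β) τ⁻¹ = δ ∧
      β = τ * (1 - (1 / δ) * avgMul μ (lam / β) τ⁻¹) := by
  unfold StateEvo
  refine and_congr_right fun hβ => and_congr_right fun hτ => ?_
  have ha : 0 ≤ lam / β := by positivity
  simp only [mul_div_assoc, eta_mul_sub hτ ha, eta'_mul hτ, mul_pow, avgMul_eq ha]
  rw [integral_const_mul]
  refine and_congr_left fun _ => ?_
  change τ ^ 2 = σ ^ 2 + 1 / δ * (τ ^ 2 * avgSq μ (lam / β) τ⁻¹) ↔ _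
  field_simp
  constructor <;> intro h <;> linarith

/-! ### The objective -/

lemma integrable_scalarInner (hmom : Integrable (fun x : ℝ => |x|) μ) {lam β τ : ℝ}
    (hlam : 0 ≤ lam) (hβ : 0 ≤ β) (hτ : 0 < τ) :
    Integrable (fun q : ℝ × ℝ => scalarInner lam β τ q.1 q.2) (μ.prod stdG) := by
  rcases hβ.eq_or_lt with rfl | hβ
  · simp only [scalarInner_zero hlam]
    exact ((hmom.comp_fst stdG).const_mul lam).neg
  simp only [scalarInner_eq hlam hβ hτ]
  set a := lam / β
  have ha : 0 ≤ a := by positivity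
  unfold innerObj
  have hdiff : Integrable (fun q : ℝ × ℝ => lam * |τ * clip (τ⁻¹ * q.1) q.2 a + q.1|
      - lam * |q.1|) (μ.prod stdG) := by
    refine integrable_prod_of_le_sq (Continuous.measurable (by fun_prop))
      (lam * τ * (a + 1)) (lam * τ) fun q => ?_
    rw [← mul_sub, abs_mul, abs_of_nonneg hlam]
    calc lam * |(|τ * clip (τ⁻¹ * q.1) q.2 a + q.1| - |q.1|)|
        ≤ lam * |τ * clip (τ⁻¹ * q.1) q.2 a + q.1 - q.1| := by
          exact mul_le_mul_of_nonneg_left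
            (abs_abs_sub_abs_le (τ * clip (τ⁻¹ * q.1) q.2 a + q.1) q.1) hlam
      _ = lam * τ * |clip (τ⁻¹ * q.1) q.2 a| := by
          rw [add_sub_cancel_right, abs_mul, abs_of_pos hτ, mul_assoc]
      _ ≤ lam * τ * (a + 1 + |q.2| ^ 2) := by
          gcongr
          have := abs_clip_le (τ⁻¹ * q.1) q.2 a
          rw [abs_of_nonneg ha] at this
          nlinarith [sq_nonneg (|q.2| - 1)]
      _ = _ := by ring
  refine ((((integrable_clip_sq a τ⁻¹).const_mul (τ * β / 2)).sub
    ((integrable_mul_clip a τ⁻¹).const_mul (β * τ))).add hdiff).congr (ae_of_all _ fun q => ?_)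
  simp only [Pi.add_apply, Pi.sub_apply]
  field_simp
  ring

/-- The objective lies below its expansion in `β` at a point where the partial derivative
vanishes. -/
lemma psiFn_le_of_stationary (hmom : Integrable (fun x : ℝ => |x|) μ) {δ σ lam β τ : ℝ}
    (hδ : 0 < δ) (hlam : 0 < lam) (h : StateEvo δ σ μ lam β τ) {β' : ℝ} (hβ' : 0 ≤ β') :
    psiFn δ σ μ lam β' τ ≤ psiFn δ σ μ lam β τ - (β' - β) ^ 2 / 2 := by
  obtain ⟨hβ, hτ, h1, h2⟩ := (stateEvo_iff hδ hlam).1 h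
  set a := lam / β with ha
  have hs : Integrable (fun q : ℝ × ℝ => 1 / 2 * clip (τ⁻¹ * q.1) q.2 a ^ 2
      - q.2 * clip (τ⁻¹ * q.1) q.2 a) (μ.prod stdG) :=
    ((integrable_clip_sq a τ⁻¹).const_mul _).sub (integrable_mul_clip a τ⁻¹)
  have hle : ∫ q : ℝ × ℝ, scalarInner lam β' τ q.1 q.2 ∂(μ.prod stdG)
      ≤ ∫ q : ℝ × ℝ, (scalarInner lam β τ q.1 q.2
        + (β' - β) * τ * (1 / 2 * clip (τ⁻¹ * q.1) q.2 a ^ 2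
          - q.2 * clip (τ⁻¹ * q.1) q.2 a)) ∂(μ.prod stdG) := by
    refine integral_mono (integrable_scalarInner hmom hlam.le hβ' hτ)
      ((integrable_scalarInner hmom hlam.le hβ.le hτ).add (hs.const_mul _))
      fun q => ?_
    refine (scalarInner_le hlam.le hβ' hτ q.1 q.2 (τ * clip (τ⁻¹ * q.1) q.2 a)).trans
      (le_of_eq ?_)
    simp only [scalarInner_eq hlam.le hβ hτ, innerObj, ← ha]
    field_simp
    ring
  rw [integral_add (integrable_scalarInner hmom hlam.le hβ.le hτ) (hs.const_mul _),
    integral_const_mul, integral_sub ((integrable_clip_sq a τ⁻¹).const_mul _)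
      (integrable_mul_clip a τ⁻¹), integral_const_mul] at hle
  change _ ≤ _ + (β' - β) * τ * (1 / 2 * avgSq μ a τ⁻¹ - avgMul μ a τ⁻¹) at hle
  have hle' := mul_le_mul_of_nonneg_left hle (by positivity : 0 ≤ 1 / δ)
  unfold psiFn
  generalize ∫ q : ℝ × ℝ, scalarInner lam β' τ q.1 q.2 ∂(μ.prod stdG) = I' at *
  generalize ∫ q : ℝ × ℝ, scalarInner lam β τ q.1 q.2 ∂(μ.prod stdG) = I at *
  have e1 : avgSq μ a τ⁻¹ = δ - δ * σ ^ 2 * τ⁻¹ ^ 2 := by linarith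
  have e2 : avgMul μ a τ⁻¹ = δ * (1 - β / τ) := by
    generalize avgMul μ a τ⁻¹ = m at h2
    rw [h2]; field_simp; ring
  rw [e1, e2] at hle'
  have e3 : 1 / δ * (I + (β' - β) * τ * (1 / 2 * (δ - δ * σ ^ 2 * τ⁻¹ ^ 2) - δ * (1 - β / τ)))
      = 1 / δ * I + (β' - β) * (β - τ / 2 - σ ^ 2 / τ / 2) := by
    field_simp; ring
  rw [e3] at hle'
  linear_combination hle'

lemma le_psiFn_of_stationary (hmom : Integrable (fun x : ℝ => |x|) μ) {δ σ lam β τ : ℝ}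
    (hδ : 0 < δ) (hlam : 0 < lam) (h : StateEvo δ σ μ lam β τ) {τ' : ℝ} (hτ' : 0 < τ') :
    psiFn δ σ μ lam β τ + β / 2 * (σ ^ 2 * (τ' - τ) ^ 2 / (τ ^ 2 * τ')) ≤
      psiFn δ σ μ lam β τ' := by
  obtain ⟨hβ, hτ, h1, h2⟩ := (stateEvo_iff hδ hlam).1 h
  set a := lam / β with ha
  have hle : ∫ q : ℝ × ℝ, (scalarInner lam β τ q.1 q.2
        - (τ' - τ) * (β / 2 * clip (τ⁻¹ * q.1) q.2 a ^ 2)) ∂(μ.prod stdG)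
      ≤ ∫ q : ℝ × ℝ, scalarInner lam β τ' q.1 q.2 ∂(μ.prod stdG) := by
    refine integral_mono ((integrable_scalarInner hmom hlam.le hβ.le hτ).sub
        (((integrable_clip_sq a τ⁻¹).const_mul _).const_mul _))
      (integrable_scalarInner hmom hlam.le hβ.le hτ') fun q => ?_
    simp only [scalarInner_eq hlam.le hβ hτ, scalarInner_eq hlam.le hβ hτ', ← ha]
    exact innerObj_ge hlam.le hβ hτ hτ' _ _ _
  rw [integral_sub (integrable_scalarInner hmom hlam.le hβ.le hτ)
      (((integrable_clip_sq a τ⁻¹).const_mul _).const_mul _),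
    integral_const_mul, integral_const_mul] at hle
  change _ - (τ' - τ) * (β / 2 * avgSq μ a τ⁻¹) ≤ _ at hle
  have hle' := mul_le_mul_of_nonneg_left hle (by positivity : 0 ≤ 1 / δ)
  unfold psiFn
  generalize ∫ q : ℝ × ℝ, scalarInner lam β τ' q.1 q.2 ∂(μ.prod stdG) = I' at *
  generalize ∫ q : ℝ × ℝ, scalarInner lam β τ q.1 q.2 ∂(μ.prod stdG) = I at *
  have e1 : avgSq μ a τ⁻¹ = δ - δ * σ ^ 2 * τ⁻¹ ^ 2 := by linarith
  rw [e1] at hle'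
  have e3 : 1 / δ * (I - (τ' - τ) * (β / 2 * (δ - δ * σ ^ 2 * τ⁻¹ ^ 2)))
      = 1 / δ * I - (τ' - τ) * (β / 2) + (τ' - τ) * (β / 2) * (σ ^ 2 / τ ^ 2) := by
    field_simp
    ring
  have e4 : σ ^ 2 * (τ' - τ) ^ 2 / (τ ^ 2 * τ')
      = σ ^ 2 / τ' - σ ^ 2 / τ + (τ' - τ) * (σ ^ 2 / τ ^ 2) := by
    field_simp; ring
  rw [e3] at hle'
  rw [e4]
  linear_combination hle'

end Averages

/-- A solution of the state evolution system is a max–min point. -/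
lemma StateEvo.isMaxMin {μ : Measure ℝ} [IsProbabilityMeasure μ]
    (hmom : Integrable (fun x : ℝ => |x|) μ) {δ σ lam β τ : ℝ}
    (hδ : 0 < δ) (hσ : 0 < σ) (hlam : 0 < lam) (h : StateEvo δ σ μ lam β τ) :
    IsMaxMin (psiFn δ σ μ lam) σ β τ := by
  obtain ⟨hβ, hτ, h1, -⟩ := (stateEvo_iff hδ hlam).1 h
  have hστ : σ ≤ τ := by
    have h3 : δ * σ ^ 2 * τ⁻¹ ^ 2 ≤ δ := by linarith [avgSq_nonneg μ (lam / β) τ⁻¹]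
    have h4 : σ ^ 2 ≤ τ ^ 2 := by
      field_simp at h3
      linarith
    exact (pow_le_pow_iff_left₀ hσ.le hτ.le two_ne_zero).1 h4
  refine ⟨hβ.le, hστ, fun τ' hτ' => ?_, fun β' hβ' ε hε => ⟨τ, hστ, ?_⟩⟩
  · have hτ'0 : 0 < τ' := hσ.trans_le hτ'
    have := le_psiFn_of_stationary hmom hδ hlam h hτ'0
    have h5 : 0 ≤ β / 2 * (σ ^ 2 * (τ' - τ) ^ 2 / (τ ^ 2 * τ')) := by positivity
    change psiFn δ σ μ lam β τ ≤ psiFn δ σ μ lam β τ'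
    linarith
  · have := psiFn_le_of_stationary hmom hδ hlam h hβ'
    nlinarith [sq_nonneg (β' - β)]

/-- Every max–min point equals the solution of the state evolution system, if there is one. -/
lemma StateEvo.eq_of_isMaxMin {μ : Measure ℝ} [IsProbabilityMeasure μ]
    (hmom : Integrable (fun x : ℝ => |x|) μ) {δ σ lam β τ β' τ' : ℝ}
    (hδ : 0 < δ) (hσ : 0 < σ) (hlam : 0 < lam) (h : StateEvo δ σ μ lam β τ)
    (h' : IsMaxMin (psiFn δ σ μ lam) σ β' τ') : β' = β ∧ τ' = τ := by
  obtain ⟨hβ0, hτσ, hmin, -⟩ := h.isMaxMin hmom hδ hσ hlam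
  obtain ⟨hβ'0, hτ'σ, hmin', hmax'⟩ := h'
  have hle : psiFn δ σ μ lam β τ ≤ psiFn δ σ μ lam β' τ' := by
    refine le_of_forall_pos_le_add fun ε hε => ?_
    obtain ⟨t, ht, hlt⟩ := hmax' β hβ0 ε hε
    exact (hmin ht).trans hlt.le
  have h1 := psiFn_le_of_stationary hmom hδ hlam h hβ'0
  have h2 : psiFn δ σ μ lam β' τ' ≤ psiFn δ σ μ lam β' τ := hmin' hτσ
  have hβ : β' = β := by nlinarith [sq_nonneg (β' - β)]
  subst hβ
  refine ⟨rfl, ?_⟩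
  have hτ'0 : 0 < τ' := hσ.trans_le hτ'σ
  have hτ0 : 0 < τ := h.2.1
  have h3 := le_psiFn_of_stationary hmom hδ hlam h hτ'0
  by_contra hne
  have h4 : 0 < (τ' - τ) ^ 2 := by positivity [sub_ne_zero.2 hne]
  have h5 : 0 < β' / 2 * (σ ^ 2 * (τ' - τ) ^ 2 / (τ ^ 2 * τ')) := by
    have := h.1
    positivity
  linarith
/-! ### The averages at zero signal -/

/-- `E (|Z| - a)₊` for a standard Gaussian `Z`. -/
def excess (a : ℝ) : ℝ := ∫ z, max (|z| - a) 0 ∂stdG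

lemma integrable_excess {a : ℝ} (ha : 0 ≤ a) : Integrable (fun z => max (|z| - a) 0) stdG := by
  refine integrable_of_le_sq (Continuous.aestronglyMeasurable (by fun_prop)) 1 1 fun z => ?_
  rw [abs_of_nonneg (le_max_right _ _)]
  exact max_le (by nlinarith [sq_nonneg (|z| - 1), abs_nonneg z]) (by positivity)

lemma integrable_excess_sq {a : ℝ} (ha : 0 ≤ a) :
    Integrable (fun z => max (|z| - a) 0 ^ 2) stdG := by
  refine integrable_of_le_sq (Continuous.aestronglyMeasurable (by fun_prop)) 0 1 fun z => ?_
  rw [abs_pow, abs_of_nonneg (le_max_right _ _), zero_add, one_mul]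
  exact pow_le_pow_left₀ (le_max_right _ _) (max_le (by linarith) (abs_nonneg z)) 2

section ZeroSignal

variable {μ : Measure ℝ} [IsProbabilityMeasure μ]

lemma avgSq_zero_eq {a : ℝ} (ha : 0 ≤ a) :
    avgSq μ a 0 = ∫ z, max (|z| - a) 0 ^ 2 ∂stdG := by
  simp only [avgSq_zero, clip_zero_sq ha]

lemma avgSq_zero_zero : avgSq μ 0 0 = 1 := by
  rw [avgSq_zero_eq le_rfl, ← integral_sq_stdG]
  simp

lemma excess_pos {a : ℝ} (ha : 0 ≤ a) (h : 0 < avgSq μ a 0) : 0 < excess a := by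
  refine lt_of_le_of_ne (integral_nonneg fun z => le_max_right _ _) fun h0 => h.ne' ?_
  have hz := (integral_eq_zero_iff_of_nonneg (fun z => le_max_right _ _)
    (integrable_excess ha)).1 h0.symm
  rw [avgSq_zero_eq ha]
  refine integral_eq_zero_of_ae ?_
  filter_upwards [hz] with z hz
  simp only [Pi.zero_apply] at hz ⊢
  rw [hz]
  norm_num

lemma avgSq_zero_add_le {a a' : ℝ} (ha : 0 ≤ a) (haa : a ≤ a') :
    avgSq μ a' 0 + 2 * (a' - a) * excess a' ≤ avgSq μ a 0 := by
  have ha' : 0 ≤ a' := ha.trans haa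
  rw [avgSq_zero_eq ha, avgSq_zero_eq ha', excess, ← integral_const_mul,
    ← integral_add (integrable_excess_sq ha') ((integrable_excess ha').const_mul _)]
  refine integral_mono ((integrable_excess_sq ha').add ((integrable_excess ha').const_mul _))
    (integrable_excess_sq ha) fun z => ?_
  change max (|z| - a') 0 ^ 2 + 2 * (a' - a) * max (|z| - a') 0 ≤ max (|z| - a) 0 ^ 2
  rcases le_total (|z|) a' with h | h
  · rw [max_eq_right (by linarith)]
    norm_num
  · rw [max_eq_left (by linarith), max_eq_left (by linarith)]
    nlinarith [sq_nonneg (a' - a)]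

lemma avgSq_zero_anti {a a' : ℝ} (ha : 0 ≤ a) (haa : a ≤ a') : avgSq μ a' 0 ≤ avgSq μ a 0 := by
  have h1 : 0 ≤ excess a' := integral_nonneg fun z => le_max_right _ _
  nlinarith [avgSq_zero_add_le (μ := μ) ha haa, mul_nonneg (sub_nonneg.2 haa) h1]

lemma avgSq_zero_lt {a a' : ℝ} (ha : 0 ≤ a) (haa : a < a') (h : 0 < avgSq μ a' 0) :
    avgSq μ a' 0 < avgSq μ a 0 := by
  nlinarith [avgSq_zero_add_le (μ := μ) ha haa.le,
    mul_pos (sub_pos.2 haa) (excess_pos (ha.trans haa.le) h)]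

lemma avgSq_zero_mul_le {a : ℝ} (ha : 0 ≤ a) : avgSq μ a 0 * a ≤ ∫ z, |z| ^ 3 ∂stdG := by
  rw [avgSq_zero_eq ha, ← integral_mul_const]
  refine integral_mono ((integrable_excess_sq ha).mul_const a) (integrable_pow_stdG 3) fun z => ?_
  change max (|z| - a) 0 ^ 2 * a ≤ |z| ^ 3
  rcases le_total (|z|) a with h | h
  · rw [max_eq_right (by linarith)]
    norm_num
  · rw [max_eq_left (by linarith), pow_succ (|z|) 2]
    have := abs_nonneg z
    gcongr
    linarith

lemma exists_avgSq_zero_eq {δ : ℝ} (hδ : 0 < δ) (hδ1 : δ < 1) :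
    ∃ α, 0 < α ∧ avgSq μ α 0 = δ := by
  set M := ∫ z, |z| ^ 3 ∂stdG with hM
  have hM0 : 0 ≤ M := integral_nonneg fun z => by positivity
  set A := M / δ + 1 with hA
  have hA0 : 0 < A := by positivity
  have hAδ : avgSq μ A 0 ≤ δ := by
    have h1 := avgSq_zero_mul_le (μ := μ) hA0.le
    rw [← hM] at h1
    have h2 : δ * A = M + δ := by rw [hA]; field_simp
    nlinarith
  have hc : Continuous fun a => avgSq μ a 0 :=
    continuous_avgSq.comp (by fun_prop : Continuous fun a : ℝ => (a, (0 : ℝ)))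
  obtain ⟨α, hα, h⟩ := intermediate_value_Icc' hA0.le hc.continuousOn
    ⟨hAδ, by simpa only [avgSq_zero_zero] using hδ1.le⟩
  refine ⟨α, lt_of_le_of_ne hα.1 ?_, h⟩
  rintro rfl
  simp only [avgSq_zero_zero] at h
  linarith

lemma avgMul_zero {a : ℝ} (ha : 0 ≤ a) : avgMul μ a 0 = avgSq μ a 0 + a * excess a := by
  simp only [avgMul, zero_mul]
  rw [integral_snd fun z => z * clip 0 z a, avgSq_zero_eq ha, excess, ← integral_const_mul,
    ← integral_add (integrable_excess_sq ha) ((integrable_excess ha).const_mul _)]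
  congr 1 with z
  have h1 : |clip 0 z a| = max (|z| - a) 0 := by
    rw [← abs_of_nonneg (le_max_right (|z| - a) 0), ← sq_eq_sq_iff_abs_eq_abs]
    exact clip_zero_sq ha z
  have h2 := sub_clip_mul ha 0 z
  rw [add_zero, h1] at h2
  rw [← clip_zero_sq ha, ← h2]
  ring

end ZeroSignal

/-! ### Bounds on the averages -/

section Bounds

variable {μ : Measure ℝ} [IsProbabilityMeasure μ]

lemma avgMul_nonneg {a : ℝ} (ha : 0 ≤ a) (s : ℝ) : 0 ≤ avgMul μ a s := by
  rw [avgMul_eq ha]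
  exact integral_nonneg fun q => eta'_nonneg _ _

lemma mul_avgMul_le (hmom : Integrable (fun x : ℝ => |x|) μ) {a s r : ℝ} (ha : 0 ≤ a)
    (hs : 0 ≤ s) (hsr : s ≤ r) :
    a * avgMul μ a s ≤ ∫ q : ℝ × ℝ, (r * |q.1| + |q.2|) ∂(μ.prod stdG) := by
  rw [avgMul_eq ha, ← integral_const_mul]
  have hZ : Integrable (fun z : ℝ => |z|) stdG := by simpa using integrable_pow_stdG 1
  refine integral_mono ((integrable_eta' a s).const_mul a)
    (((hmom.comp_fst stdG).const_mul r).add (hZ.comp_snd μ)) fun q => ?_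
  change a * eta' (s * q.1 + q.2) a ≤ r * |q.1| + |q.2|
  have h1 : |s * q.1 + q.2| ≤ r * |q.1| + |q.2| := by
    refine (abs_add_le _ _).trans ?_
    rw [abs_mul, abs_of_nonneg hs]
    gcongr
  unfold eta'
  split_ifs with h
  · linarith
  · linarith [abs_nonneg (s * q.1 + q.2)]

lemma avgSq_le {a : ℝ} (ha : 0 ≤ a) (s : ℝ) : avgSq μ a s ≤ 2 * avgMul μ a s - 1 + a ^ 2 := by
  have hZ : ∫ q : ℝ × ℝ, q.2 ^ 2 ∂(μ.prod stdG) = 1 := by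
    rw [integral_snd fun z => z ^ 2, integral_sq_stdG]
  have hM := (integrable_mul_clip (μ := μ) a s).const_mul 2
  have hQ : Integrable (fun q : ℝ × ℝ => a ^ 2 - q.2 ^ 2) (μ.prod stdG) :=
    (integrable_const _).sub integrable_snd_sq
  have hle : avgSq μ a s ≤ ∫ q : ℝ × ℝ, (2 * (q.2 * clip (s * q.1) q.2 a)
      + (a ^ 2 - q.2 ^ 2)) ∂(μ.prod stdG) := by
    refine integral_mono (integrable_clip_sq a s) (hM.add hQ) fun q => ?_
    change clip (s * q.1) q.2 a ^ 2 ≤ 2 * (q.2 * clip (s * q.1) q.2 a) + (a ^ 2 - q.2 ^ 2)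
    have := pow_le_pow_left₀ (abs_nonneg _) (abs_sub_clip_le ha (s * q.1) q.2) 2
    rw [sq_abs] at this
    linarith
  rw [integral_add hM hQ, integral_const_mul, integral_sub (integrable_const _) integrable_snd_sq,
    hZ] at hle
  simp only [integral_const, probReal_univ, smul_eq_mul, one_mul] at hle
  change _ ≤ 2 * avgMul μ a s + _ at hle
  linarith

lemma gphi_le_gphi {x y : ℝ} (h : |x| ≤ |y|) : gphi y ≤ gphi x := by
  unfold gphi
  have := sq_le_sq.2 h
  gcongr

lemma gphi_mul_le_integral {a : ℝ} (ha : 0 ≤ a) (t : ℝ) :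
    2 * a * gphi (|t| + a) ≤ ∫ z, (1 - eta' (t + z) a) ∂stdG := by
  have hint : Integrable (fun z => 1 - eta' (t + z) a) stdG :=
    (integrable_const _).sub (integrable_eta'_stdG t a)
  rw [integral_stdG]
  have hI : 2 * a * gphi (|t| + a)
      = ∫ z, (Set.Icc (-t - a) (-t + a)).indicator (fun _ => gphi (|t| + a)) z := by
    rw [integral_indicator measurableSet_Icc, setIntegral_const, Real.volume_real_Icc_of_le
      (by linarith), smul_eq_mul]
    ring
  rw [hI]
  refine integral_mono ?_ ((integrable_stdG_iff _).1 hint) fun z => ?_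
  · exact (integrable_indicator_iff measurableSet_Icc).2
      (integrableOn_const (by simp))
  · change Set.indicator _ _ z ≤ gphi z * (1 - eta' (t + z) a)
    by_cases hz : z ∈ Set.Icc (-t - a) (-t + a)
    · have h1 : |t + z| ≤ a := abs_le.2 ⟨by linarith [hz.1], by linarith [hz.2]⟩
      rw [Set.indicator_of_mem hz, eta', if_neg h1.not_gt, sub_zero, mul_one]
      refine gphi_le_gphi ?_
      rw [abs_of_nonneg (by positivity : 0 ≤ |t| + a), abs_le]
      constructor <;> linarith [hz.1, hz.2, neg_abs_le t, le_abs_self t]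
    · rw [Set.indicator_of_notMem hz]
      exact mul_nonneg (gphi_pos z).le (by linarith [eta'_le_one (t + z) a])

lemma integrable_gphi_comp (r : ℝ) : Integrable (fun θ => gphi (r * |θ| + 1)) μ := by
  refine Integrable.mono' (integrable_const (gphi 0))
    (continuous_gphi.comp (by fun_prop)).aestronglyMeasurable (ae_of_all _ fun θ => ?_)
  rw [Real.norm_of_nonneg (gphi_pos _).le]
  exact gphi_le_gphi (by simp)

lemma integral_gphi_comp_pos (r : ℝ) : 0 < ∫ θ, gphi (r * |θ| + 1) ∂μ := by
  rw [integral_pos_iff_support_of_nonneg (fun θ => (gphi_pos _).le) (integrable_gphi_comp r)]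
  have : Function.support (fun θ => gphi (r * |θ| + 1)) = Set.univ :=
    Set.eq_univ_of_forall fun θ => (gphi_pos _).ne'
  simp [this]

lemma avgMul_le {a s r : ℝ} (ha : 0 ≤ a) (ha1 : a ≤ 1) (hs : 0 ≤ s) (hsr : s ≤ r) :
    avgMul μ a s ≤ 1 - 2 * a * ∫ θ, gphi (r * |θ| + 1) ∂μ := by
  have hint : Integrable (fun q : ℝ × ℝ => 1 - eta' (s * q.1 + q.2) a) (μ.prod stdG) :=
    (integrable_const _).sub (integrable_eta' a s)
  have h1 : 1 - avgMul μ a s = ∫ θ, ∫ z, (1 - eta' (s * θ + z) a) ∂stdG ∂μ := by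
    rw [← integral_prod _ hint, integral_sub (integrable_const _) (integrable_eta' a s),
      avgMul_eq ha]
    simp
  have h2 : 2 * a * ∫ θ, gphi (r * |θ| + 1) ∂μ ≤ 1 - avgMul μ a s := by
    rw [h1, ← integral_const_mul]
    refine integral_mono ((integrable_gphi_comp r).const_mul _) hint.integral_prod_left fun θ => ?_
    refine le_trans ?_ (gphi_mul_le_integral ha (s * θ))
    refine mul_le_mul_of_nonneg_left (gphi_le_gphi ?_) (by positivity)
    have hr : 0 ≤ r := hs.trans hsr
    rw [abs_of_nonneg (by positivity : 0 ≤ |s * θ| + a),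
      abs_of_nonneg (by positivity : 0 ≤ r * |θ| + 1), abs_mul, abs_of_nonneg hs]
    gcongr
  linarith

end Bounds

/-! ### Existence of a solution of the state evolution system -/

/-- The first state evolution equation, with `a = λ / β` and `s = 1 / τ`, reads
`balance δ σ μ a s = δ`. -/
def balance (δ σ : ℝ) (μ : Measure ℝ) (a s : ℝ) : ℝ := δ * σ ^ 2 * s ^ 2 + avgSq μ a s

lemma balance_zero (δ σ : ℝ) (μ : Measure ℝ) (a : ℝ) : balance δ σ μ a 0 = avgSq μ a 0 := by
  simp [balance]

section Existence

variable {μ : Measure ℝ} [IsProbabilityMeasure μ]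

lemma continuous_balance (δ σ : ℝ) : Continuous fun p : ℝ × ℝ => balance δ σ μ p.1 p.2 := by
  unfold balance
  exact Continuous.add (by fun_prop) continuous_avgSq

lemma balance_strictMonoOn {δ σ a : ℝ} (hδ : 0 < δ) (hσ : 0 < σ) (ha : 0 ≤ a) :
    StrictMonoOn (balance δ σ μ a) (Set.Ici 0) := by
  intro s hs s' _ hss
  have hs0 : 0 ≤ s := hs
  unfold balance
  have h1 := avgSq_mono (μ := μ) ha hs0 hss.le
  have h2 : δ * σ ^ 2 * s ^ 2 < δ * σ ^ 2 * s' ^ 2 := by gcongr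
  linarith

lemma exists_balance_eq {δ σ a : ℝ} (hσ : 0 < σ) (h : avgSq μ a 0 < δ) :
    ∃ s, 0 < s ∧ s ≤ σ⁻¹ ∧ balance δ σ μ a s = δ := by
  have hc : Continuous (balance δ σ μ a) :=
    (continuous_balance δ σ).comp (by fun_prop : Continuous fun s : ℝ => (a, s))
  have h1 : δ ≤ balance δ σ μ a σ⁻¹ := by
    have : δ * σ ^ 2 * σ⁻¹ ^ 2 = δ := by field_simp
    rw [balance, this]
    linarith [avgSq_nonneg μ a σ⁻¹]
  obtain ⟨s, hs, hsδ⟩ := intermediate_value_Icc (inv_pos.2 hσ).le hc.continuousOn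
    ⟨by rw [balance_zero]; exact h.le, h1⟩
  refine ⟨s, lt_of_le_of_ne hs.1 ?_, hs.2, hsδ⟩
  rintro rfl
  rw [balance_zero] at hsδ
  linarith

/-- The solution `s` of `balance δ σ μ a s = δ` depends continuously on `a`. -/
lemma exists_continuousOn_balance_eq {δ σ : ℝ} (hδ : 0 < δ) (hσ : 0 < σ) :
    ∃ s : ℝ → ℝ, ContinuousOn s {a | 0 < a ∧ avgSq μ a 0 < δ} ∧
      ∀ a, 0 < a → avgSq μ a 0 < δ → 0 < s a ∧ s a ≤ σ⁻¹ ∧ balance δ σ μ a (s a) = δ := by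
  have hex : ∀ a, ∃ s, avgSq μ a 0 < δ → 0 < s ∧ s ≤ σ⁻¹ ∧ balance δ σ μ a s = δ := fun a => by
    by_cases h : avgSq μ a 0 < δ
    · obtain ⟨s, hs⟩ := exists_balance_eq hσ h
      exact ⟨s, fun _ => hs⟩
    · exact ⟨0, fun h' => absurd h' h⟩
  choose s hs using hex
  refine ⟨s, fun a ⟨ha, haδ⟩ => ?_, fun a _ h => hs a h⟩
  have hc : ∀ u, ContinuousAt (fun a => balance δ σ μ a u) a := fun u =>
    ((continuous_balance δ σ).comp
      (by fun_prop : Continuous fun a : ℝ => (a, u))).continuousAt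
  obtain ⟨hsa, -, hsδ⟩ := hs a haδ
  refine tendsto_order.2 ⟨fun l hl => ?_, fun u hu => ?_⟩
  · rcases lt_or_ge l 0 with h0 | h0
    · filter_upwards [self_mem_nhdsWithin] with b hb
      exact h0.trans (hs b hb.2).1
    · have h1 : balance δ σ μ a l < δ :=
        (balance_strictMonoOn hδ hσ ha.le h0 hsa.le hl).trans_eq hsδ
      filter_upwards [self_mem_nhdsWithin,
        ((hc l).eventually_lt continuousAt_const h1).filter_mono nhdsWithin_le_nhds] with b hb hbl
      obtain ⟨hsb, -, hbδ⟩ := hs b hb.2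
      have hbl' : balance δ σ μ b l < balance δ σ μ b (s b) := hbl.trans_eq hbδ.symm
      exact ((balance_strictMonoOn hδ hσ hb.1.le).lt_iff_lt h0 hsb.le).1 hbl'
  · have hu0 : 0 ≤ u := hsa.le.trans hu.le
    have h1 : δ < balance δ σ μ a u :=
      hsδ.symm.trans_lt (balance_strictMonoOn hδ hσ ha.le hsa.le hu0 hu)
    filter_upwards [self_mem_nhdsWithin,
      (continuousAt_const.eventually_lt (hc u) h1).filter_mono nhdsWithin_le_nhds] with b hb hbu
    obtain ⟨hsb, -, hbδ⟩ := hs b hb.2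
    have hbu' : balance δ σ μ b (s b) < balance δ σ μ b u := hbδ.trans_lt hbu
    exact ((balance_strictMonoOn hδ hσ hb.1.le).lt_iff_lt hsb.le hu0).1 hbu'

lemma exists_stateEvo_of_le (hmom : Integrable (fun x : ℝ => |x|) μ) {δ σ lam a₁ : ℝ}
    (hδ : 0 < δ) (hσ : 0 < σ) (hlam : 0 < lam) (ha₁ : 0 < a₁) (ha₁δ : avgSq μ a₁ 0 < δ)
    (hle : ∀ s, 0 < s → s ≤ σ⁻¹ → balance δ σ μ a₁ s = δ →
      a₁ * (1 - avgMul μ a₁ s / δ) ≤ lam * s) :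
    ∃ β τ, StateEvo δ σ μ lam β τ := by
  obtain ⟨s, hsc, hs⟩ := exists_continuousOn_balance_eq (μ := μ) hδ hσ
  set K := ∫ q : ℝ × ℝ, (σ⁻¹ * |q.1| + |q.2|) ∂(μ.prod stdG) with hK
  set a₂ := max a₁ (K / δ + lam * σ⁻¹)
  have hmem : ∀ a, a₁ ≤ a → 0 < a ∧ avgSq μ a 0 < δ := fun a ha =>
    ⟨ha₁.trans_le ha, (avgSq_zero_anti ha₁.le ha).trans_lt ha₁δ⟩
  have hsc' : ContinuousOn s (Set.Icc a₁ a₂) := hsc.mono fun a ha => hmem a ha.1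
  have hm : ContinuousOn (fun a => avgMul μ a (s a)) (Set.Icc a₁ a₂) :=
    continuous_avgMul.comp_continuousOn (continuousOn_id.prodMk hsc')
  have hF : ContinuousOn (fun a => a * (1 - avgMul μ a (s a) / δ) - lam * s a)
      (Set.Icc a₁ a₂) := by fun_prop
  have h1 : a₁ * (1 - avgMul μ a₁ (s a₁) / δ) - lam * s a₁ ≤ 0 := by
    obtain ⟨h1, h2, h3⟩ := hs a₁ ha₁ ha₁δ
    linarith [hle _ h1 h2 h3]
  have h2 : 0 ≤ a₂ * (1 - avgMul μ a₂ (s a₂) / δ) - lam * s a₂ := by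
    have ha₂ := hmem a₂ (le_max_left _ _)
    obtain ⟨h1, h2, -⟩ := hs a₂ ha₂.1 ha₂.2
    have h3 := mul_avgMul_le hmom ha₂.1.le h1.le h2
    rw [← hK] at h3
    have h4 : a₂ * avgMul μ a₂ (s a₂) / δ ≤ K / δ := by gcongr
    have h5 : lam * s a₂ ≤ lam * σ⁻¹ := by gcongr
    have h6 : K / δ + lam * σ⁻¹ ≤ a₂ := le_max_right _ _
    rw [mul_sub, mul_one, ← mul_div_assoc]
    linarith
  obtain ⟨a, ha, h0⟩ := intermediate_value_Icc (le_max_left _ _) hF ⟨h1, h2⟩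
  obtain ⟨ha0, haδ⟩ := hmem a ha.1
  obtain ⟨hs0, -, hsδ⟩ := hs a ha0 haδ
  have hla : lam / (lam / a) = a := by field_simp
  refine ⟨lam / a, (s a)⁻¹, (stateEvo_iff hδ hlam).2
    ⟨by positivity, by positivity, by rw [hla, inv_inv]; exact hsδ, ?_⟩⟩
  rw [hla, inv_inv]
  simp only at h0
  generalize avgMul μ a (s a) = m at h0
  field_simp at h0 ⊢
  linarith

lemma exists_stateEvo_of_lt_one (hmom : Integrable (fun x : ℝ => |x|) μ) {δ σ lam : ℝ}
    (hδ : 0 < δ) (hδ1 : δ < 1) (hσ : 0 < σ) (hlam : 0 < lam) :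
    ∃ β τ, StateEvo δ σ μ lam β τ := by
  obtain ⟨α, hα, hαδ⟩ := exists_avgSq_zero_eq (μ := μ) hδ hδ1
  have hm : δ < avgMul μ α 0 := by
    rw [avgMul_zero hα.le, hαδ]
    have := excess_pos (μ := μ) hα.le (hαδ ▸ hδ)
    nlinarith
  have hnear : ∀ᶠ p : ℝ × ℝ in 𝓝 (α, 0), δ < avgMul μ p.1 p.2 :=
    continuousAt_const.eventually_lt continuous_avgMul.continuousAt hm
  obtain ⟨ε, hε, hball⟩ := Metric.eventually_nhds_iff.1 hnear
  have hG : δ < balance δ σ μ α (ε / 2) := by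
    refine ((balance_zero δ σ μ α).trans hαδ).symm.trans_lt ?_
    exact balance_strictMonoOn hδ hσ hα.le (Set.mem_Ici.2 le_rfl)
      (Set.mem_Ici.2 (by positivity)) (by positivity)
  have hGnear : ∀ᶠ a in 𝓝 α, δ < balance δ σ μ a (ε / 2) :=
    continuousAt_const.eventually_lt ((continuous_balance δ σ).comp
      (by fun_prop : Continuous fun a : ℝ => (a, ε / 2))).continuousAt hG
  obtain ⟨a, ⟨hGa, hadist⟩, haα⟩ := (((hGnear.and (Metric.ball_mem_nhds α hε)).filter_mono
    nhdsWithin_le_nhds).and (self_mem_nhdsWithin (s := Set.Ioi α))).exists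
  have haα : α < a := haα
  have ha0 : 0 < a := hα.trans haα
  have haδ : avgSq μ a 0 < δ := by
    by_contra! h
    linarith [avgSq_zero_lt (μ := μ) hα.le haα (hδ.trans_le h)]
  refine exists_stateEvo_of_le hmom hδ hσ hlam ha0 haδ fun s hs _ hsδ => ?_
  have hsε : s < ε / 2 := by
    exact ((balance_strictMonoOn hδ hσ ha0.le).lt_iff_lt hs.le
      (Set.mem_Ici.2 (by positivity))).1 (hsδ.trans_lt hGa)
  have h1 : δ < avgMul μ a s := by
    refine hball (y := (a, s)) ?_
    rw [Prod.dist_eq, max_lt_iff]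
    refine ⟨hadist, ?_⟩
    rw [Real.dist_eq, sub_zero, abs_of_pos hs]
    linarith
  have h2 : 1 < avgMul μ a s / δ := (one_lt_div hδ).2 h1
  nlinarith [mul_pos hlam hs]

lemma exists_stateEvo_of_one_le (hmom : Integrable (fun x : ℝ => |x|) μ) {δ σ lam : ℝ}
    (hδ1 : 1 ≤ δ) (hσ : 0 < σ) (hlam : 0 < lam) :
    ∃ β τ, StateEvo δ σ μ lam β τ := by
  have hδ : 0 < δ := one_pos.trans_le hδ1
  set c := ∫ θ, gphi (σ⁻¹ * |θ| + 1) ∂μ with hc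
  have hc0 : 0 < c := integral_gphi_comp_pos _
  have hD : 0 < δ * σ ^ 2 + lam ^ 2 := by positivity
  set a := min 1 (4 * c * lam ^ 2 / (δ * σ ^ 2 + lam ^ 2)) with ha
  have ha0 : 0 < a := lt_min one_pos (by positivity)
  have ha1 : a ≤ 1 := min_le_left _ _
  have ha2 : a * (δ * σ ^ 2 + lam ^ 2) ≤ 4 * c * lam ^ 2 :=
    (le_div_iff₀ hD).1 (min_le_right _ _)
  have hsq : ∀ s, 0 ≤ s → s ≤ σ⁻¹ → avgSq μ a s ≤ 1 - 4 * c * a + a ^ 2 := fun s h0 h1 => by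
    have := avgMul_le (μ := μ) ha0.le ha1 h0 h1
    rw [← hc] at this
    linarith [avgSq_le (μ := μ) ha0.le s]
  have hac : a < 4 * c := by
    by_contra! h
    have h1 : 0 < a * (δ * σ ^ 2) := by positivity
    nlinarith [mul_le_mul_of_nonneg_right h (sq_nonneg lam)]
  have haδ : avgSq μ a 0 < δ := by
    have := hsq 0 le_rfl (by positivity)
    nlinarith
  refine exists_stateEvo_of_le hmom hδ hσ hlam ha0 haδ fun s hs hsσ hsδ => ?_
  have h1 : a * (4 * c - a) ≤ δ * σ ^ 2 * s ^ 2 := by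
    unfold balance at hsδ
    linarith [hsq s hs.le hsσ]
  have h2 : a ^ 2 * (δ * σ ^ 2) ≤ (lam * s) ^ 2 * (δ * σ ^ 2) := by
    nlinarith [mul_le_mul_of_nonneg_left h1 (sq_nonneg lam),
      mul_le_mul_of_nonneg_left ha2 ha0.le]
  have h3 : a ≤ lam * s := by
    refine (pow_le_pow_iff_left₀ ha0.le (by positivity) two_ne_zero).1 ?_
    exact le_of_mul_le_mul_right h2 (by positivity)
  have h4 : 0 ≤ avgMul μ a s / δ := div_nonneg (avgMul_nonneg ha0.le s) hδ.le
  nlinarith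

lemma exists_stateEvo (hmom : Integrable (fun x : ℝ => |x|) μ) {δ σ lam : ℝ}
    (hδ : 0 < δ) (hσ : 0 < σ) (hlam : 0 < lam) : ∃ β τ, StateEvo δ σ μ lam β τ := by
  rcases lt_or_ge δ 1 with h | h
  · exact exists_stateEvo_of_lt_one hmom hδ h hσ hlam
  · exact exists_stateEvo_of_one_le hmom h hσ hlam

lemma StateEvo.lt_div {δ σ lam β τ α : ℝ} (hδ : 0 < δ) (hσ : 0 < σ) (hlam : 0 < lam)
    (h : StateEvo δ σ μ lam β τ) (hα : 0 < α) (hαδ : avgSq μ α 0 = δ) : β < lam / α := by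
  obtain ⟨hβ, hτ, h1, -⟩ := (stateEvo_iff hδ hlam).1 h
  have ha : 0 < lam / β := by positivity
  have hs : 0 < δ * σ ^ 2 * τ⁻¹ ^ 2 := by positivity
  have h2 : avgSq μ (lam / β) 0 < avgSq μ α 0 := by
    linarith [avgSq_mono (μ := μ) ha.le le_rfl (inv_pos.2 hτ).le]
  have h3 : α < lam / β := by
    by_contra! h3
    exact h2.not_ge (avgSq_zero_anti ha.le h3)
  rw [lt_div_iff₀ hα]
  rw [lt_div_iff₀ hβ] at h3
  linarith

end Existence

lemma tail_eq_iff (μ : Measure ℝ) [IsProbabilityMeasure μ] {α δ : ℝ} (hα : 0 ≤ α) :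
    (1 + α ^ 2) * gPhi (-α) - α * gphi α = δ / 2 ↔ avgSq μ α 0 = δ := by
  rw [avgSq_zero, integral_clip_zero_sq hα]
  constructor <;> intro h <;> linarith

lemma existsUnique_tail_eq {δ : ℝ} (hδ : 0 < δ) (hδ1 : δ < 1) :
    ∃! α : ℝ, 0 < α ∧ (1 + α ^ 2) * gPhi (-α) - α * gphi α = δ / 2 := by
  obtain ⟨α, hα, hαδ⟩ := exists_avgSq_zero_eq (μ := stdG) hδ hδ1
  refine ⟨α, ⟨hα, (tail_eq_iff stdG hα.le).2 hαδ⟩, fun α' ⟨hα', h'⟩ => ?_⟩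
  rw [tail_eq_iff stdG hα'.le] at h'
  rcases lt_trichotomy α' α with h | h | h
  · linarith [avgSq_zero_lt (μ := stdG) hα'.le h (hαδ ▸ hδ)]
  · exact h
  · linarith [avgSq_zero_lt (μ := stdG) hα.le h (h' ▸ hδ)]

/-- Proposition 1 / Theorem (scalar max–min problem): the max–min of ψ_λ is
achieved at a unique pair (β⋆, τ⋆), which is also the unique positive solution
of the state evolution system; moreover 0 < β⋆ < λ/α_min(δ) when δ ∈ (0,1). -/
theorem stmt9 (δ σ lam : ℝ) (hδ : 0 < δ) (hσ : 0 < σ) (hlam : 0 < lam)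
    (P0 : Measure ℝ) [IsProbabilityMeasure P0]
    (hmom : Integrable (fun x : ℝ => |x|) P0) :
    ∃ βs τs : ℝ,
      IsMaxMin (psiFn δ σ P0 lam) σ βs τs ∧
      (∀ β τ : ℝ, IsMaxMin (psiFn δ σ P0 lam) σ β τ → β = βs ∧ τ = τs) ∧
      StateEvo δ σ P0 lam βs τs ∧
      (∀ β τ : ℝ, StateEvo δ σ P0 lam β τ → β = βs ∧ τ = τs) ∧
      (δ < 1 →
        (∃! α : ℝ, 0 < α ∧ (1 + α ^ 2) * gPhi (-α) - α * gphi α = δ / 2) ∧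
        0 < βs ∧
        ∀ α : ℝ, 0 < α → (1 + α ^ 2) * gPhi (-α) - α * gphi α = δ / 2 →
          βs < lam / α) := by
  obtain ⟨β, τ, h⟩ := exists_stateEvo hmom hδ hσ hlam
  exact ⟨β, τ, h.isMaxMin hmom hδ hσ hlam, fun _ _ h' => h.eq_of_isMaxMin hmom hδ hσ hlam h', h,
    fun _ _ h' => h.eq_of_isMaxMin hmom hδ hσ hlam (h'.isMaxMin hmom hδ hσ hlam),
    fun hδ1 => ⟨existsUnique_tail_eq hδ hδ1, h.1, fun _ hα hαδ =>
      h.lt_div hδ hσ hlam hα ((tail_eq_iff P0 hα.le).1 hαδ)⟩⟩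
end
end

section
/- Let S_w ⊂ ℝ^N and S_u ⊂ ℝⁿ be compact sets and Q : S_w × S_u → ℝ continuous. Let G ∈ ℝ^{n×N} have i.i.d. N(0,1) entries, and let g ~ N(0, I_N), h ~ N(0, I_n) be independent standard Gaussian vectors. Define C⋆(G) = min_{w ∈ S_w} max_{u ∈ S_u} { uᵀGw + Q(w,u) } and L⋆(g,h) = min_{w ∈ S_w} max_{u ∈ S_u} { ‖u‖ gᵀw + ‖w‖ hᵀu + Q(w,u) }. Then: (i) for all t ∈ ℝ, P(C⋆(G) ≤ t) ≤ 2 P(L⋆(g,h) ≤ t); (ii) if moreover S_w and S_u are convex and Q is convex in w and concave in u, then for all t ∈ ℝ, P(C⋆(G) ≥ t) ≤ 2 P(L⋆(g,h) ≥ t). -/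
open MeasureTheory ProbabilityTheory
open scoped ENNReal NNReal

noncomputable section

/-- Euclidean norm of a vector. -/
def l2 {k : ℕ} (x : Fin k → ℝ) : ℝ := Real.sqrt (∑ i, (x i) ^ 2)

/-- Law of a matrix with i.i.d. standard Gaussian entries. -/
def PG (n N : ℕ) : Measure (Fin n → Fin N → ℝ) :=
  Measure.pi fun _ => Measure.pi fun _ => gaussianReal 0 1

/-- Joint law of independent standard Gaussian vectors (g, h). -/
def Pgh (n N : ℕ) : Measure ((Fin N → ℝ) × (Fin n → ℝ)) :=
  (Measure.pi fun _ => gaussianReal 0 1).prod (Measure.pi fun _ => gaussianReal 0 1)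

/-- C⋆(G) = min_{w ∈ S_w} max_{u ∈ S_u} { uᵀGw + Q(w,u) }. -/
def Cstar {n N : ℕ} (Sw : Set (Fin N → ℝ)) (Su : Set (Fin n → ℝ))
    (Q : (Fin N → ℝ) → (Fin n → ℝ) → ℝ) (G : Fin n → Fin N → ℝ) : ℝ :=
  sInf ((fun w => sSup ((fun u => (∑ i, u i * ∑ j, G i j * w j) + Q w u) '' Su)) '' Sw)

/-- L⋆(g,h) = min_{w ∈ S_w} max_{u ∈ S_u} { ‖u‖gᵀw + ‖w‖hᵀu + Q(w,u) }. -/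
def Lstar {n N : ℕ} (Sw : Set (Fin N → ℝ)) (Su : Set (Fin n → ℝ))
    (Q : (Fin N → ℝ) → (Fin n → ℝ) → ℝ) (g : Fin N → ℝ) (h : Fin n → ℝ) : ℝ :=
  sInf ((fun w => sSup ((fun u =>
    l2 u * (∑ j, g j * w j) + l2 w * (∑ i, h i * u i) + Q w u) '' Su)) '' Sw)

section BoundedDerivatives

variable {E : Type*} [NormedAddCommGroup E] [NormedSpace ℝ E]

/-- A `C³` function that is bounded together with its derivatives up to order three. -/
def HasBoundedDerivs (f : E → ℝ) : Prop :=
  ContDiff ℝ 3 f ∧ ∀ k : ℕ, k ≤ 3 → ∃ C : ℝ, ∀ x, ‖iteratedFDeriv ℝ k f x‖ ≤ C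

namespace HasBoundedDerivs

theorem const (c : ℝ) : HasBoundedDerivs (fun _ : E => c) := by
  refine ⟨contDiff_const, fun k _ => ⟨|c|, fun x => ?_⟩⟩
  rcases Nat.eq_zero_or_pos k with rfl | hk
  · simp
  · rw [iteratedFDeriv_const_of_ne hk.ne']
    simp

theorem sub {f g : E → ℝ} (hf : HasBoundedDerivs f) (hg : HasBoundedDerivs g) :
    HasBoundedDerivs (fun x => f x - g x) := by
  refine ⟨hf.1.sub hg.1, fun k hk => ?_⟩
  obtain ⟨C, hC⟩ := hf.2 k hk
  obtain ⟨D, hD⟩ := hg.2 k hk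
  have hk' : (k : WithTop ℕ∞) ≤ 3 := by exact_mod_cast hk
  refine ⟨C + D, fun x => ?_⟩
  have h := iteratedFDeriv_sub_apply (𝕜 := ℝ) (i := k) (x := x)
    (hf.1.of_le hk').contDiffAt (hg.1.of_le hk').contDiffAt
  have h' : iteratedFDeriv ℝ k (fun x => f x - g x) x
      = iteratedFDeriv ℝ k f x - iteratedFDeriv ℝ k g x := h
  rw [h']
  exact (norm_sub_le _ _).trans (add_le_add (hC x) (hD x))

theorem mul {f g : E → ℝ} (hf : HasBoundedDerivs f) (hg : HasBoundedDerivs g) :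
    HasBoundedDerivs (fun x => f x * g x) := by
  refine ⟨hf.1.mul hg.1, fun k hk => ?_⟩
  choose! C hC using hf.2
  choose! D hD using hg.2
  have hk' : (k : WithTop ℕ∞) ≤ 3 := by exact_mod_cast hk
  refine ⟨∑ i ∈ Finset.range (k + 1), (k.choose i : ℝ) * C i * D (k - i), fun x => ?_⟩
  refine (norm_iteratedFDeriv_mul_le hf.1 hg.1 x hk').trans (Finset.sum_le_sum fun i hi => ?_)
  have hi' : i ≤ 3 := by have := Finset.mem_range.1 hi; omega
  have h1 := hC i hi' x
  have h2 := hD (k - i) (by omega) x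
  have h3 : 0 ≤ C i := (norm_nonneg _).trans h1
  gcongr

theorem prod {ι : Type*} (s : Finset ι) {f : ι → E → ℝ} (hf : ∀ i ∈ s, HasBoundedDerivs (f i)) :
    HasBoundedDerivs (fun x => ∏ i ∈ s, f i x) := by
  classical
  induction s using Finset.induction_on with
  | empty => simpa using const (E := E) 1
  | insert a s ha ih =>
    simp only [Finset.prod_insert ha]
    exact (hf a (Finset.mem_insert_self a s)).mul
      (ih fun i hi => hf i (Finset.mem_insert_of_mem hi))

theorem comp_clm {f : ℝ → ℝ} (hf : HasBoundedDerivs f) (L : E →L[ℝ] ℝ) :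
    HasBoundedDerivs (fun x => f (L x)) := by
  refine ⟨hf.1.comp L.contDiff, fun k hk => ?_⟩
  obtain ⟨C, hC⟩ := hf.2 k hk
  have hk' : (k : WithTop ℕ∞) ≤ 3 := by exact_mod_cast hk
  refine ⟨C * ∏ _i : Fin k, ‖L‖, fun x => ?_⟩
  have h : iteratedFDeriv ℝ k (fun x => f (L x)) x = _ :=
    L.iteratedFDeriv_comp_right hf.1 x hk'
  rw [h]
  refine (ContinuousMultilinearMap.norm_compContinuousLinearMap_le _ _).trans ?_
  have := hC (L x)
  gcongr

theorem of_eq_const_outside {f : ℝ → ℝ} (hf : ContDiff ℝ 4 f) {a b c d : ℝ}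
    (ha : ∀ x ≤ a, f x = c) (hb : ∀ x, b ≤ x → f x = d) (hbd : ∃ C, ∀ x, |f x| ≤ C) :
    HasBoundedDerivs f := by
  refine ⟨hf.of_le (by norm_num), fun k hk => ?_⟩
  rcases k with _ | k
  · obtain ⟨C, hC⟩ := hbd
    exact ⟨C, fun x => by simpa using hC x⟩
  · have hs : HasCompactSupport (fderiv ℝ f) := by
      refine HasCompactSupport.intro (isCompact_Icc (a := a) (b := b)) fun x hx => ?_
      rw [Set.mem_Icc, not_and_or, not_le, not_le] at hx
      rcases hx with hx | hx
      · have : f =ᶠ[nhds x] fun _ => c := by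
          filter_upwards [Iio_mem_nhds hx] with y hy using ha y (le_of_lt hy)
        rw [this.fderiv_eq]; simp
      · have : f =ᶠ[nhds x] fun _ => d := by
          filter_upwards [Ioi_mem_nhds hx] with y hy using hb y (le_of_lt hy)
        rw [this.fderiv_eq]; simp
    have hc : ContDiff ℝ 3 (fderiv ℝ f) := hf.fderiv_right (by norm_num)
    have hk' : (k : WithTop ℕ∞) ≤ 3 := by exact_mod_cast (show k ≤ 3 by omega)
    obtain ⟨C, hC⟩ := (hs.iteratedFDeriv (𝕜 := ℝ) k).exists_bound_of_continuous
      (hc.continuous_iteratedFDeriv hk')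
    exact ⟨C, fun x => by rw [← norm_iteratedFDeriv_fderiv]; exact hC x⟩

set_option maxSynthPendingDepth 3 in
theorem taylor {f : E → ℝ} (hf : HasBoundedDerivs f) :
    ∃ M : ℝ, 0 ≤ M ∧ ∀ p v : E,
      |f (p + v) - f p - fderiv ℝ f p v - (1 / 2) * fderiv ℝ (fderiv ℝ f) p v v| ≤ M * ‖v‖ ^ 3 := by
  obtain ⟨M, hM⟩ := hf.2 3 le_rfl
  have hM' : ∀ x, ‖fderiv ℝ (fderiv ℝ (fderiv ℝ f)) x‖ ≤ M := fun x => by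
    rw [← norm_iteratedFDeriv_one, norm_iteratedFDeriv_fderiv, norm_iteratedFDeriv_fderiv]
    exact hM x
  have hM0 : 0 ≤ M := (norm_nonneg _).trans (hM 0)
  have hf1 : ContDiff ℝ 2 (fderiv ℝ f) := hf.1.fderiv_right (by norm_num)
  have hf2 : ContDiff ℝ 1 (fderiv ℝ (fderiv ℝ f)) := hf1.fderiv_right (by norm_num)
  have hd0 : Differentiable ℝ f := hf.1.differentiable (by norm_num)
  have hd1 : Differentiable ℝ (fderiv ℝ f) := hf1.differentiable (by norm_num)
  have hd2 : Differentiable ℝ (fderiv ℝ (fderiv ℝ f)) := hf2.differentiable (by norm_num)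
  have hH : ∀ x y, ‖fderiv ℝ (fderiv ℝ f) y - fderiv ℝ (fderiv ℝ f) x‖ ≤ M * ‖y - x‖ :=
    fun x y => Convex.norm_image_sub_le_of_norm_fderiv_le (𝕜 := ℝ) (fun z _ => hd2 z)
      (fun z _ => hM' z) convex_univ (Set.mem_univ x) (Set.mem_univ y)
  refine ⟨M, hM0, fun p v => ?_⟩
  have hline : ∀ r : ℝ, HasDerivAt (fun r : ℝ => p + r • v) v r := fun r => by
    simpa using ((hasDerivAt_id r).smul_const v).const_add p
  have hD : ∀ r ∈ Set.Icc (0 : ℝ) 1,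
      ‖fderiv ℝ f (p + r • v) v - fderiv ℝ f p v - r * fderiv ℝ (fderiv ℝ f) p v v‖
        ≤ M * ‖v‖ ^ 3 := by
    intro r hr
    have hg : ∀ s ∈ Set.Icc (0 : ℝ) r, HasDerivWithinAt
        (fun s : ℝ => fderiv ℝ f (p + s • v) v - s * fderiv ℝ (fderiv ℝ f) p v v)
        (fderiv ℝ (fderiv ℝ f) (p + s • v) v v - fderiv ℝ (fderiv ℝ f) p v v)
        (Set.Icc 0 r) s := by
      intro s _
      have h0 : HasDerivAt (fun s : ℝ => fderiv ℝ f (p + s • v))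
          (fderiv ℝ (fderiv ℝ f) (p + s • v) v) s :=
        HasFDerivAt.comp_hasDerivAt s (hd1 (p + s • v)).hasFDerivAt (hline s)
      have h1 : HasDerivAt (fun s : ℝ => fderiv ℝ f (p + s • v) v)
          (fderiv ℝ (fderiv ℝ f) (p + s • v) v v) s := by
        simpa using h0.clm_apply (hasDerivAt_const s v)
      have h2 : HasDerivAt (fun s : ℝ => s * fderiv ℝ (fderiv ℝ f) p v v)
          (fderiv ℝ (fderiv ℝ f) p v v) s := by
        simpa using (hasDerivAt_id s).mul_const (fderiv ℝ (fderiv ℝ f) p v v)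
      exact (h1.sub h2).hasDerivWithinAt
    have hb : ∀ s ∈ Set.Ico (0 : ℝ) r,
        ‖fderiv ℝ (fderiv ℝ f) (p + s • v) v v - fderiv ℝ (fderiv ℝ f) p v v‖
          ≤ M * ‖v‖ ^ 3 := by
      intro s hs
      have h1 := hH p (p + s • v)
      have h2 : ‖p + s • v - p‖ ≤ ‖v‖ := by
        rw [add_sub_cancel_left, norm_smul, Real.norm_of_nonneg hs.1]
        exact mul_le_of_le_one_left (norm_nonneg _) (hs.2.le.trans hr.2)
      calc ‖fderiv ℝ (fderiv ℝ f) (p + s • v) v v - fderiv ℝ (fderiv ℝ f) p v v‖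
          = ‖(fderiv ℝ (fderiv ℝ f) (p + s • v) - fderiv ℝ (fderiv ℝ f) p) v v‖ := rfl
        _ ≤ ‖fderiv ℝ (fderiv ℝ f) (p + s • v) - fderiv ℝ (fderiv ℝ f) p‖ * ‖v‖ * ‖v‖ :=
            ContinuousLinearMap.le_opNorm₂ _ _ _
        _ ≤ (M * ‖v‖) * ‖v‖ * ‖v‖ := by
            gcongr
            exact h1.trans (by gcongr)
        _ = M * ‖v‖ ^ 3 := by ring
    have := norm_image_sub_le_of_norm_deriv_le_segment' hg hb r ⟨hr.1, le_rfl⟩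
    simp only [zero_smul, add_zero, zero_mul, sub_zero] at this
    rw [sub_right_comm]
    refine this.trans ?_
    exact mul_le_of_le_one_right (by positivity) hr.2
  have hg : ∀ r ∈ Set.Icc (0 : ℝ) 1, HasDerivWithinAt
      (fun r : ℝ => f (p + r • v) - r * fderiv ℝ f p v
        - r ^ 2 * ((1 / 2) * fderiv ℝ (fderiv ℝ f) p v v))
      (fderiv ℝ f (p + r • v) v - fderiv ℝ f p v - r * fderiv ℝ (fderiv ℝ f) p v v)
      (Set.Icc 0 1) r := by
    intro r _
    have h1 := (hd0 (p + r • v)).hasFDerivAt.comp_hasDerivAt r (hline r)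
    have h2 := (hasDerivAt_id r).mul_const (fderiv ℝ f p v)
    have h3 := ((hasDerivAt_id r).pow 2).mul_const ((1 / 2) * fderiv ℝ (fderiv ℝ f) p v v)
    have h4 := ((h1.sub h2).sub h3).hasDerivWithinAt (s := Set.Icc 0 1)
    convert! h4 using 1
    simp
    ring
  have := norm_image_sub_le_of_norm_deriv_le_segment_01' hg
    fun r hr => hD r ⟨hr.1, hr.2.le⟩
  simp only [zero_smul, add_zero, zero_mul, sub_zero, one_smul, one_mul, one_pow, ne_eq,
    OfNat.ofNat_ne_zero, not_false_eq_true, zero_pow] at this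
  rw [Real.norm_eq_abs] at this
  refine le_trans (le_of_eq ?_) this
  congr 1
  ring

end HasBoundedDerivs

end BoundedDerivatives
section GordonTest

variable {W U : Type*} [Fintype U]

/-- A smooth approximation, as `κ → ∞`, of the indicator of
`{x | ∀ w, ∃ u, lam w u < x (w, u)}`. -/
def gordonTest [Fintype W] (κ : ℝ) (lam : W → U → ℝ) (x : W × U → ℝ) : ℝ :=
  ∏ w, (1 - ∏ u, (1 - Real.smoothTransition (κ * (x (w, u) - lam w u))))

theorem hasBoundedDerivs_smoothTransition {κ : ℝ} (hκ : 0 < κ) (c : ℝ) :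
    HasBoundedDerivs (fun r : ℝ => Real.smoothTransition (κ * (r - c))) := by
  refine HasBoundedDerivs.of_eq_const_outside (a := c) (b := c + κ⁻¹) (c := 0) (d := 1)
    ?_ (fun x hx => ?_) (fun x hx => ?_) ⟨1, fun x => ?_⟩
  · exact Real.smoothTransition.contDiff.comp (by fun_prop)
  · exact Real.smoothTransition.zero_of_nonpos
      (mul_nonpos_of_nonneg_of_nonpos hκ.le (by linarith))
  · refine Real.smoothTransition.one_of_one_le ?_
    have : κ⁻¹ ≤ x - c := by linarith
    calc (1 : ℝ) = κ * κ⁻¹ := (mul_inv_cancel₀ hκ.ne').symm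
      _ ≤ κ * (x - c) := by gcongr
  · rw [abs_of_nonneg (Real.smoothTransition.nonneg _)]
    exact Real.smoothTransition.le_one _

theorem hasBoundedDerivs_gordonTest_factor [Fintype W] {κ : ℝ} (hκ : 0 < κ) (lam : W → U → ℝ)
    (w : W) :
    HasBoundedDerivs (fun x : W × U → ℝ =>
      1 - ∏ u, (1 - Real.smoothTransition (κ * (x (w, u) - lam w u)))) :=
  (HasBoundedDerivs.const 1).sub <| HasBoundedDerivs.prod _ fun u _ =>
    (HasBoundedDerivs.const 1).sub <|
      (hasBoundedDerivs_smoothTransition hκ (lam w u)).comp_clm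
        (ContinuousLinearMap.proj (R := ℝ) (φ := fun _ : W × U => ℝ) (w, u))

theorem hasBoundedDerivs_gordonTest [Fintype W] {κ : ℝ} (hκ : 0 < κ) (lam : W → U → ℝ) :
    HasBoundedDerivs (gordonTest κ lam) :=
  HasBoundedDerivs.prod _ fun w _ => hasBoundedDerivs_gordonTest_factor hκ lam w

theorem gordonTest_factor_mem_Icc (κ : ℝ) (lam : W → U → ℝ) (w : W) (x : W × U → ℝ) :
    1 - ∏ u, (1 - Real.smoothTransition (κ * (x (w, u) - lam w u))) ∈ Set.Icc (0 : ℝ) 1 := by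
  have h0 : 0 ≤ ∏ u, (1 - Real.smoothTransition (κ * (x (w, u) - lam w u))) :=
    Finset.prod_nonneg fun u _ => sub_nonneg.2 (Real.smoothTransition.le_one _)
  have h1 : ∏ u, (1 - Real.smoothTransition (κ * (x (w, u) - lam w u))) ≤ 1 :=
    Finset.prod_le_one (fun u _ => sub_nonneg.2 (Real.smoothTransition.le_one _))
      fun u _ => sub_le_self _ (Real.smoothTransition.nonneg _)
  exact ⟨by linarith, by linarith⟩

theorem gordonTest_mem_Icc [Fintype W] (κ : ℝ) (lam : W → U → ℝ) (x : W × U → ℝ) :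
    gordonTest κ lam x ∈ Set.Icc (0 : ℝ) 1 :=
  ⟨Finset.prod_nonneg fun w _ => (gordonTest_factor_mem_Icc κ lam w x).1,
    Finset.prod_le_one (fun w _ => (gordonTest_factor_mem_Icc κ lam w x).1)
      fun w _ => (gordonTest_factor_mem_Icc κ lam w x).2⟩

theorem gordonTest_factor_mono {κ : ℝ} (hκ : 0 < κ) (lam : W → U → ℝ) (w : W) :
    Monotone (fun x : W × U → ℝ =>
      1 - ∏ u, (1 - Real.smoothTransition (κ * (x (w, u) - lam w u)))) := by
  intro x y hxy
  refine sub_le_sub_left (Finset.prod_le_prod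
    (fun u _ => sub_nonneg.2 (Real.smoothTransition.le_one _)) fun u _ => sub_le_sub_left
      (Real.smoothTransition.monotone ?_) _) _
  have := hxy (w, u)
  gcongr

theorem fderiv_fderiv_gordonTest_nonneg [Fintype W] [DecidableEq W] [DecidableEq U]
    {κ : ℝ} (hκ : 0 < κ) (lam : W → U → ℝ) (p : W × U → ℝ) {i j : W × U} (hij : i.1 ≠ j.1) :
    0 ≤ fderiv ℝ (fderiv ℝ (gordonTest κ lam)) p (Pi.single i 1) (Pi.single j 1) := by
  classical
  set f : W → (W × U → ℝ) → ℝ := fun w x =>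
    1 - ∏ u, (1 - Real.smoothTransition (κ * (x (w, u) - lam w u))) with hf
  have hF := hasBoundedDerivs_gordonTest hκ lam
  have hd0 : Differentiable ℝ (gordonTest κ lam) := hF.1.differentiable (by norm_num)
  have hd1 : Differentiable ℝ (fderiv ℝ (gordonTest κ lam)) :=
    (hF.1.fderiv_right (m := 2) (by norm_num)).differentiable (by norm_num)
  have hfd : ∀ w, Differentiable ℝ (f w) := fun w =>
    (hasBoundedDerivs_gordonTest_factor hκ lam w).1.differentiable (by norm_num)
  have hline : ∀ (q : W × U → ℝ) (k : W × U) (r : ℝ),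
      HasDerivAt (fun r : ℝ => q + r • (Pi.single k 1 : W × U → ℝ)) (Pi.single k 1) r :=
    fun q k r => by simpa using
      ((hasDerivAt_id r).smul_const (Pi.single k 1 : W × U → ℝ)).const_add q
  have hmono : ∀ k : W × U,
      Monotone (fun r : ℝ => f k.1 (p + r • (Pi.single k 1 : W × U → ℝ))) := by
    intro k r s hrs
    refine gordonTest_factor_mono hκ lam k.1 (add_le_add_right ?_ p)
    refine smul_le_smul_of_nonneg_right hrs ?_
    exact Pi.single_nonneg.2 zero_le_one
  have hloc : ∀ (w : W) (x y : W × U → ℝ), (∀ u, x (w, u) = y (w, u)) → f w x = f w y := by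
    intro w x y h
    simp only [hf, h]
  set c : ℝ := ∏ w ∈ (Finset.univ.erase i.1).erase j.1, f w p with hc
  have hc0 : 0 ≤ c := Finset.prod_nonneg fun w _ => (gordonTest_factor_mem_Icc κ lam w p).1
  set a : ℝ → ℝ := fun t => f i.1 (p + t • (Pi.single i 1 : W × U → ℝ)) with ha
  set b : ℝ → ℝ := fun r => f j.1 (p + r • (Pi.single j 1 : W × U → ℝ)) with hb
  have had : Differentiable ℝ a := fun t =>
    ((hfd i.1 _).hasFDerivAt.comp_hasDerivAt t (hline p i t)).differentiableAt
  have hbd : Differentiable ℝ b := fun t =>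
    ((hfd j.1 _).hasFDerivAt.comp_hasDerivAt t (hline p j t)).differentiableAt
  have hfac : ∀ t r : ℝ, gordonTest κ lam
      (p + t • (Pi.single i 1 : W × U → ℝ) + r • (Pi.single j 1 : W × U → ℝ))
        = a t * (b r * c) := by
    intro t r
    have hne : ∀ (k : W × U) (w : W) (u : U), w ≠ k.1 →
        (Pi.single k 1 : W × U → ℝ) (w, u) = 0 := fun k w u h =>
      Pi.single_eq_of_ne (fun h' => h (by rw [← h'])) _
    change ∏ w, f w _ = _
    rw [← Finset.mul_prod_erase _ _ (Finset.mem_univ i.1),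
      ← Finset.mul_prod_erase _ _ (Finset.mem_erase.2 ⟨hij.symm, Finset.mem_univ j.1⟩)]
    congr 1
    · refine hloc _ _ _ fun u => ?_
      simp [hne j i.1 u hij]
    congr 1
    · refine hloc _ _ _ fun u => ?_
      simp [hne i j.1 u hij.symm]
    · refine Finset.prod_congr rfl fun w hw => hloc _ _ _ fun u => ?_
      simp only [Finset.mem_erase] at hw
      simp [hne i w u hw.2.1, hne j w u hw.1]
  have h1 : ∀ t : ℝ, fderiv ℝ (gordonTest κ lam) (p + t • (Pi.single i 1 : W × U → ℝ))
      (Pi.single j 1) = a t * (deriv b 0 * c) := by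
    intro t
    have e1 := (hd0 (p + t • (Pi.single i 1 : W × U → ℝ)
      + (0 : ℝ) • (Pi.single j 1 : W × U → ℝ))).hasFDerivAt.comp_hasDerivAt (0 : ℝ)
        (hline (p + t • (Pi.single i 1 : W × U → ℝ)) j 0)
    have e2 : HasDerivAt (fun r => a t * (b r * c)) (a t * (deriv b 0 * c)) 0 :=
      ((hbd 0).hasDerivAt.mul_const c).const_mul (a t)
    have e3 : (gordonTest κ lam ∘ fun r : ℝ => p + t • (Pi.single i 1 : W × U → ℝ)
        + r • (Pi.single j 1 : W × U → ℝ)) = fun r => a t * (b r * c) := funext (hfac t)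
    rw [e3] at e1
    have := e1.unique e2
    simpa using this
  have h2 : HasDerivAt (fun t : ℝ => fderiv ℝ (gordonTest κ lam)
      (p + t • (Pi.single i 1 : W × U → ℝ)) (Pi.single j 1))
      (fderiv ℝ (fderiv ℝ (gordonTest κ lam)) p (Pi.single i 1) (Pi.single j 1)) 0 := by
    have e0 : HasDerivAt (fun t : ℝ => fderiv ℝ (gordonTest κ lam)
        (p + t • (Pi.single i 1 : W × U → ℝ)))
        (fderiv ℝ (fderiv ℝ (gordonTest κ lam)) (p + (0 : ℝ) • Pi.single i 1)
          (Pi.single i 1)) 0 :=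
      HasFDerivAt.comp_hasDerivAt 0 (hd1 (p + (0 : ℝ) • Pi.single i 1)).hasFDerivAt (hline p i 0)
    simpa using e0.clm_apply (hasDerivAt_const 0 (Pi.single j 1))
  have h3 : HasDerivAt (fun t : ℝ => fderiv ℝ (gordonTest κ lam)
      (p + t • (Pi.single i 1 : W × U → ℝ)) (Pi.single j 1)) (deriv a 0 * (deriv b 0 * c)) 0 := by
    simp_rw [h1]
    exact (had 0).hasDerivAt.mul_const _
  rw [h2.unique h3]
  have := (hmono i).deriv_nonneg (x := 0)
  have := (hmono j).deriv_nonneg (x := 0)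
  positivity

theorem tendsto_gordonTest [Fintype W] (lam : W → U → ℝ) (x : W × U → ℝ) :
    Filter.Tendsto (fun k : ℕ => gordonTest ((k : ℝ) + 1) lam x) Filter.atTop
      (nhds (Set.indicator {x : W × U → ℝ | ∀ w, ∃ u, lam w u < x (w, u)} 1 x)) := by
  classical
  have hs : ∀ w u, Filter.Tendsto
      (fun k : ℕ => Real.smoothTransition (((k : ℝ) + 1) * (x (w, u) - lam w u))) Filter.atTop
      (nhds (if lam w u < x (w, u) then 1 else 0)) := by
    intro w u
    split_ifs with h
    · have h0 : 0 < x (w, u) - lam w u := sub_pos.2 h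
      have h1 : Filter.Tendsto (fun k : ℕ => ((k : ℝ) + 1) * (x (w, u) - lam w u))
          Filter.atTop Filter.atTop :=
        (Filter.tendsto_atTop_add_const_right _ _ tendsto_natCast_atTop_atTop).atTop_mul_const h0
      refine tendsto_const_nhds.congr' ?_
      filter_upwards [h1.eventually_ge_atTop 1] with k hk
      exact (Real.smoothTransition.one_of_one_le hk).symm
    · refine tendsto_const_nhds.congr fun k => ?_
      refine (Real.smoothTransition.zero_of_nonpos
        (mul_nonpos_of_nonneg_of_nonpos (by positivity) ?_)).symm
      linarith
  have hlim : Filter.Tendsto (fun k : ℕ => gordonTest ((k : ℝ) + 1) lam x) Filter.atTop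
      (nhds (∏ w, (1 - ∏ u, (1 - if lam w u < x (w, u) then (1 : ℝ) else 0)))) :=
    tendsto_finsetProd _ fun w _ => tendsto_const_nhds.sub <|
      tendsto_finsetProd _ fun u _ => tendsto_const_nhds.sub (hs w u)
  convert! hlim using 2
  by_cases hx : ∀ w, ∃ u, lam w u < x (w, u)
  · rw [Set.indicator_of_mem (by simpa using hx), Pi.one_apply]
    refine (Finset.prod_eq_one fun w _ => ?_).symm
    obtain ⟨u, hu⟩ := hx w
    rw [Finset.prod_eq_zero (Finset.mem_univ u) (by simp [hu]), sub_zero]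
  · rw [Set.indicator_of_notMem (by simpa using hx)]
    push Not at hx
    obtain ⟨w, hw⟩ := hx
    refine (Finset.prod_eq_zero (Finset.mem_univ w) ?_).symm
    rw [Finset.prod_eq_one fun u _ => by simp [(hw u).not_gt], sub_self]

end GordonTest
section GaussianExpansion

open scoped RealInnerProductSpace

variable {E ι : Type*} [NormedAddCommGroup E] [InnerProductSpace ℝ E]

/-- The linear map `x ↦ (⟪a i, x⟫)ᵢ`. -/
def innerFamily (a : ι → E) : E →L[ℝ] (ι → ℝ) :=
  ContinuousLinearMap.pi fun i => innerSL ℝ (a i)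

theorem innerFamily_apply (a : ι → E) (x : E) (i : ι) : innerFamily a x i = ⟪a i, x⟫ := rfl

variable [FiniteDimensional ℝ E] [MeasurableSpace E] [BorelSpace E]

theorem integral_inner_mul_inner_stdGaussian (x y : E) :
    ∫ z, ⟪x, z⟫ * ⟪y, z⟫ ∂(stdGaussian E) = ⟪x, y⟫ := by
  have h := covarianceBilin_apply
    (IsGaussian.memLp_id (stdGaussian E) 2 (by simp)) x y
  have h0 : (stdGaussian E)[id] = 0 := integral_id_stdGaussian
  rw [covarianceBilin_stdGaussian, h0] at h
  simpa [innerSL_apply_apply ℝ] using h.symm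

theorem integrable_inner_mul_inner_stdGaussian (x y : E) :
    Integrable (fun z => ⟪x, z⟫ * ⟪y, z⟫) (stdGaussian E) := by
  have h := fun v : E => IsGaussian.memLp_dual (stdGaussian E) (innerSL ℝ v) 2 (by simp)
  exact (h x).integrable_mul (h y)

theorem map_smul_stdGaussian_conv {a b c : ℝ} (h : a ^ 2 + b ^ 2 = c ^ 2) :
    ((stdGaussian E).map (fun x => a • x)).conv ((stdGaussian E).map (fun x => b • x))
      = (stdGaussian E).map (fun x => c • x) := by
  have := fun r : ℝ => Measure.isProbabilityMeasure_map (μ := stdGaussian E)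
    (f := fun x : E => r • x) (by fun_prop)
  apply Measure.ext_of_charFun
  ext t
  rw [charFun_conv, charFun_map_smul, charFun_map_smul, charFun_map_smul, charFun_stdGaussian,
    charFun_stdGaussian, charFun_stdGaussian, ← Complex.exp_add]
  congr 1
  simp only [norm_smul, mul_pow, Complex.ofReal_mul, Real.norm_eq_abs]
  have h' : ((|a| : ℝ) : ℂ) ^ 2 + ((|b| : ℝ) : ℂ) ^ 2 = ((|c| : ℝ) : ℂ) ^ 2 := by
    norm_cast
    simpa only [sq_abs] using h
  rw [← h']
  ring

theorem HasBoundedDerivs.gaussian_expansion [Fintype ι] [DecidableEq ι] {f : (ι → ℝ) → ℝ}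
    (hf : HasBoundedDerivs f) (a : ι → E) :
    ∃ C : ℝ, 0 ≤ C ∧ ∀ (p : ι → ℝ) (ε : ℝ), 0 ≤ ε →
      |∫ x, f (p + ε • innerFamily a x) ∂(stdGaussian E) - f p
        - ε ^ 2 / 2 * ∑ i, ∑ j, ⟪a i, a j⟫ *
          fderiv ℝ (fderiv ℝ f) p (Pi.single i 1) (Pi.single j 1)| ≤ C * ε ^ 3 := by
  obtain ⟨M, hM0, hM⟩ := hf.taylor
  have h3 : Integrable (fun x => ‖innerFamily a x‖ ^ 3) (stdGaussian E) := by
    have h1 := (IsGaussian.memLp_id (stdGaussian E) 3 (by simp)).continuousLinearMap_comp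
      (innerFamily a)
    exact h1.integrable_norm_pow (by norm_num)
  refine ⟨M * ∫ x, ‖innerFamily a x‖ ^ 3 ∂(stdGaussian E),
    mul_nonneg hM0 (integral_nonneg fun x => by positivity), fun p ε hε => ?_⟩
  obtain ⟨B, hB⟩ := hf.2 0 (by norm_num)
  have i1 : Integrable (fun x => f (p + ε • innerFamily a x)) (stdGaussian E) := by
    refine Integrable.of_bound ?_ B (.of_forall fun x => by simpa using hB _)
    exact (hf.1.continuous.comp (by fun_prop)).aestronglyMeasurable
  set L : StrongDual ℝ E := ε • (fderiv ℝ f p).comp (innerFamily a) with hL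
  have i2 : Integrable (fun x => L x) (stdGaussian E) := IsGaussian.integrable_dual _ L
  set H := fderiv ℝ (fderiv ℝ f) p with hH
  have hexp : ∀ x, H (ε • innerFamily a x) (ε • innerFamily a x)
      = ε ^ 2 * ∑ i, ∑ j, ⟪a i, x⟫ * ⟪a j, x⟫ * H (Pi.single i 1) (Pi.single j 1) := by
    intro x
    have e : innerFamily a x = ∑ i, ⟪a i, x⟫ • (Pi.single i 1 : ι → ℝ) := by
      ext k
      simp [innerFamily_apply, Finset.sum_apply, Pi.single_apply]
    rw [map_smul, map_smul, smul_apply, smul_eq_mul, smul_eq_mul, ← mul_assoc,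
      ← sq]
    congr 1
    conv_lhs => rw [e]
    simp only [map_sum, map_smul, sum_apply, smul_apply,
      smul_eq_mul, Finset.mul_sum, mul_assoc]
    rw [Finset.sum_comm]
    refine Finset.sum_congr rfl fun i _ => Finset.sum_congr rfl fun j _ => ?_
    ring
  have i3' : ∀ i j, Integrable
      (fun x => ⟪a i, x⟫ * ⟪a j, x⟫ * H (Pi.single i 1) (Pi.single j 1)) (stdGaussian E) :=
    fun i j => (integrable_inner_mul_inner_stdGaussian (a i) (a j)).mul_const _
  have i3 : Integrable (fun x => (1 / 2) * H (ε • innerFamily a x) (ε • innerFamily a x))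
      (stdGaussian E) := by
    simp_rw [hexp]
    exact ((integrable_finsetSum _ fun i _ => integrable_finsetSum _ fun j _ =>
      i3' i j).const_mul _).const_mul _
  have e3 : ∫ x, (1 / 2) * H (ε • innerFamily a x) (ε • innerFamily a x) ∂(stdGaussian E)
      = ε ^ 2 / 2 * ∑ i, ∑ j, ⟪a i, a j⟫ * H (Pi.single i 1) (Pi.single j 1) := by
    simp_rw [hexp]
    rw [integral_const_mul, integral_const_mul,
      integral_finsetSum _ fun i _ => integrable_finsetSum _ fun j _ => i3' i j]
    simp_rw [integral_finsetSum _ fun j _ => i3' _ j, integral_mul_const,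
      integral_inner_mul_inner_stdGaussian]
    ring
  have e2 : ∫ x, L x ∂(stdGaussian E) = 0 := integral_strongDual_stdGaussian L
  have key : ∫ x, (f (p + ε • innerFamily a x) - f p - L x
      - (1 / 2) * H (ε • innerFamily a x) (ε • innerFamily a x)) ∂(stdGaussian E)
      = ∫ x, f (p + ε • innerFamily a x) ∂(stdGaussian E) - f p
        - ε ^ 2 / 2 * ∑ i, ∑ j, ⟪a i, a j⟫ * H (Pi.single i 1) (Pi.single j 1) := by
    have i1' : Integrable (fun x => f (p + ε • innerFamily a x) - f p) (stdGaussian E) :=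
      i1.sub (integrable_const _)
    have i12 : Integrable (fun x => f (p + ε • innerFamily a x) - f p - L x) (stdGaussian E) :=
      i1'.sub i2
    rw [integral_sub i12 i3, integral_sub i1' i2, integral_sub i1 (integrable_const _), e2, e3]
    simp
  rw [← key, ← Real.norm_eq_abs]
  refine (norm_integral_le_integral_norm _).trans ?_
  rw [mul_assoc, ← integral_mul_const, ← integral_const_mul]
  refine integral_mono_of_nonneg (.of_forall fun x => norm_nonneg _)
    ((h3.mul_const _).const_mul _) (.of_forall fun x => ?_)
  have := hM p (ε • innerFamily a x)
  rw [norm_smul, Real.norm_of_nonneg hε, mul_pow, mul_comm (ε ^ 3), map_smul] at this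
  simpa [hL] using this

end GaussianExpansion

section Lindeberg

variable {V : Type*} [NormedAddCommGroup V] [SecondCountableTopology V]
  [MeasurableSpace V] [BorelSpace V]

theorem integral_conv_translate {μ ν : Measure V} [IsProbabilityMeasure μ]
    [IsProbabilityMeasure ν] {F : V → ℝ} (hF : Continuous F) {B : ℝ} (hB : ∀ x, ‖F x‖ ≤ B)
    (p : V) : ∫ z, F (p + z) ∂(μ.conv ν) = ∫ x, ∫ y, F (p + x + y) ∂ν ∂μ := by
  have hi : Integrable (fun z => F (p + z)) (μ.conv ν) :=
    .of_bound (hF.comp (by fun_prop)).aestronglyMeasurable B (.of_forall fun x => hB _)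
  rw [integral_conv hi]
  simp_rw [add_assoc]

theorem lindeberg_exchange {μ ν : ℕ → Measure V} {μ₁ ν₁ : Measure V}
    [∀ k, IsProbabilityMeasure (μ k)] [∀ k, IsProbabilityMeasure (ν k)]
    [IsProbabilityMeasure μ₁] [IsProbabilityMeasure ν₁]
    (h0 : ν 0 = μ 0) (hμ : ∀ k, μ (k + 1) = (μ k).conv μ₁) (hν : ∀ k, ν (k + 1) = ν₁.conv (ν k))
    {F : V → ℝ} (hF : Continuous F) {B : ℝ} (hB : ∀ x, ‖F x‖ ≤ B) {c : ℝ}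
    (hstep : ∀ p, ∫ y, F (p + y) ∂ν₁ ≤ ∫ x, F (p + x) ∂μ₁ + c) (k : ℕ) (p : V) :
    ∫ y, F (p + y) ∂(ν k) ≤ ∫ x, F (p + x) ∂(μ k) + k * c := by
  have hi2 : ∀ (ρ σ : Measure V) [IsProbabilityMeasure ρ] [IsProbabilityMeasure σ] (p : V),
      Integrable (Function.uncurry fun x y => F (p + x + y)) (ρ.prod σ) := fun ρ σ _ _ p =>
    Integrable.of_bound (hF.comp (by fun_prop)).aestronglyMeasurable B (.of_forall fun x => hB _)
  have hi : ∀ (ρ σ : Measure V) [IsProbabilityMeasure ρ] [IsProbabilityMeasure σ] (p : V),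
      Integrable (fun x => ∫ y, F (p + x + y) ∂σ) ρ := fun ρ σ _ _ p =>
    (hi2 ρ σ p).integral_prod_left
  induction k generalizing p with
  | zero => simp [h0]
  | succ k ih =>
    rw [hμ, hν, integral_conv_translate hF hB, integral_conv_translate hF hB]
    calc ∫ x, ∫ y, F (p + x + y) ∂(ν k) ∂ν₁
        ≤ ∫ x, (∫ y, F (p + x + y) ∂(μ k) + k * c) ∂ν₁ :=
          integral_mono (hi ν₁ (ν k) p) ((hi ν₁ (μ k) p).add (integrable_const _))
            fun x => ih (p + x)
      _ = ∫ y, ∫ x, F (p + y + x) ∂ν₁ ∂(μ k) + k * c := by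
          rw [integral_add (hi ν₁ (μ k) p) (integrable_const _),
            integral_integral_swap (hi2 ν₁ (μ k) p)]
          simp [add_right_comm]
      _ ≤ ∫ y, (∫ x, F (p + y + x) ∂μ₁ + c) ∂(μ k) + k * c := by
          refine add_le_add ?_ le_rfl
          exact integral_mono (hi (μ k) ν₁ p) ((hi (μ k) μ₁ p).add (integrable_const _))
            fun y => hstep (p + y)
      _ = _ := by
          rw [integral_add (hi (μ k) μ₁ p) (integrable_const _)]
          simp
          ring

end Lindeberg

section Gordon

open scoped RealInnerProductSpace

variable {E E' W U : Type*} [NormedAddCommGroup E] [InnerProductSpace ℝ E]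
  [FiniteDimensional ℝ E] [MeasurableSpace E] [BorelSpace E]
  [NormedAddCommGroup E'] [InnerProductSpace ℝ E'] [FiniteDimensional ℝ E'] [MeasurableSpace E']
  [BorelSpace E'] [Fintype W] [Fintype U]

instance isProbabilityMeasure_map_smul_innerFamily {ι : Type*} [Fintype ι] (a : ι → E) (r : ℝ) :
    IsProbabilityMeasure (((stdGaussian E).map (fun x => r • x)).map (innerFamily a)) := by
  have := Measure.isProbabilityMeasure_map (μ := stdGaussian E)
    (f := fun x : E => r • x) (by fun_prop)
  exact Measure.isProbabilityMeasure_map (by fun_prop)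

theorem map_smul_innerFamily_conv {ι : Type*} [Fintype ι] (a : ι → E) {r s t : ℝ}
    (h : r ^ 2 + s ^ 2 = t ^ 2) :
    (((stdGaussian E).map (fun x => r • x)).map (innerFamily a)).conv
      (((stdGaussian E).map (fun x => s • x)).map (innerFamily a))
      = ((stdGaussian E).map (fun x => t • x)).map (innerFamily a) := by
  have := fun r : ℝ => Measure.isProbabilityMeasure_map (μ := stdGaussian E)
    (f := fun x : E => r • x) (by fun_prop)
  rw [← Measure.map_conv_continuousLinearMap, map_smul_stdGaussian_conv h]

theorem integral_map_smul_innerFamily {ι : Type*} [Fintype ι] (a : ι → E) (r : ℝ)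
    {F : (ι → ℝ) → ℝ} (hF : Continuous F) (p : ι → ℝ) :
    ∫ y, F (p + y) ∂(((stdGaussian E).map (fun x => r • x)).map (innerFamily a))
      = ∫ x, F (p + r • innerFamily a x) ∂(stdGaussian E) := by
  have hc : Continuous fun y => F (p + y) := hF.comp (by fun_prop)
  have hc' : Continuous fun x => F (p + innerFamily a x) := hF.comp (by fun_prop)
  rw [integral_map (by fun_prop) hc.aestronglyMeasurable, integral_map (by fun_prop)
    hc'.aestronglyMeasurable]
  simp

theorem integral_gordonTest_le {a : W × U → E} {b : W × U → E'}
    (heq : ∀ i j, i.1 = j.1 → ⟪a i, a j⟫ = ⟪b i, b j⟫)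
    (hle : ∀ i j, i.1 ≠ j.1 → ⟪b i, b j⟫ ≤ ⟪a i, a j⟫)
    {κ : ℝ} (hκ : 0 < κ) (lam : W → U → ℝ) :
    ∫ y, gordonTest κ lam (innerFamily b y) ∂(stdGaussian E')
      ≤ ∫ x, gordonTest κ lam (innerFamily a x) ∂(stdGaussian E) := by
  classical
  set F := gordonTest κ lam with hFdef
  have hF := hasBoundedDerivs_gordonTest hκ lam
  have hFB : ∀ x, ‖F x‖ ≤ 1 := fun x => by
    obtain ⟨h0, h1⟩ := gordonTest_mem_Icc κ lam x
    rwa [Real.norm_of_nonneg h0]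
  obtain ⟨C, hC, hCa⟩ := hF.gaussian_expansion a
  obtain ⟨D, hD, hDb⟩ := hF.gaussian_expansion b
  have hstep : ∀ (ε : ℝ), 0 ≤ ε → ∀ p,
      ∫ y, F (p + ε • innerFamily b y) ∂(stdGaussian E')
        ≤ ∫ x, F (p + ε • innerFamily a x) ∂(stdGaussian E) + (C + D) * ε ^ 3 := by
    intro ε hε p
    have h1 := (abs_le.1 (hCa p ε hε)).1
    have h2 := (abs_le.1 (hDb p ε hε)).2
    have h3 : ∑ i, ∑ j, ⟪b i, b j⟫ * fderiv ℝ (fderiv ℝ F) p (Pi.single i 1) (Pi.single j 1)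
        ≤ ∑ i, ∑ j, ⟪a i, a j⟫ * fderiv ℝ (fderiv ℝ F) p (Pi.single i 1) (Pi.single j 1) := by
      refine Finset.sum_le_sum fun i _ => Finset.sum_le_sum fun j _ => ?_
      by_cases hij : i.1 = j.1
      · rw [heq i j hij]
      · exact mul_le_mul_of_nonneg_right (hle i j hij)
          (fderiv_fderiv_gordonTest_nonneg hκ lam p hij)
    have h4 := mul_le_mul_of_nonneg_left h3 (by positivity : 0 ≤ ε ^ 2 / 2)
    linarith
  have hm : ∀ m : ℕ, ∫ y, F (innerFamily b y) ∂(stdGaussian E')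
      ≤ ∫ x, F (innerFamily a x) ∂(stdGaussian E) + (C + D) * (√(m + 1))⁻¹ := by
    intro m
    set ε : ℝ := (√(m + 1))⁻¹ with hε
    have hε0 : 0 < ε := by positivity
    have hε2 : ε ^ 2 = ((m : ℝ) + 1)⁻¹ := by
      rw [hε, inv_pow, Real.sq_sqrt (by positivity)]
    have hsq : ∀ k : ℕ, (√k * ε) ^ 2 + ε ^ 2 = (√(k + 1 : ℕ) * ε) ^ 2 := fun k => by
      rw [mul_pow, mul_pow, Real.sq_sqrt (by positivity), Real.sq_sqrt (by positivity)]
      push_cast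
      ring
    have h := lindeberg_exchange
      (μ := fun k => ((stdGaussian E).map (fun x => (√k * ε) • x)).map (innerFamily a))
      (ν := fun k => ((stdGaussian E').map (fun x => (√k * ε) • x)).map (innerFamily b))
      (μ₁ := ((stdGaussian E).map (fun x => ε • x)).map (innerFamily a))
      (ν₁ := ((stdGaussian E').map (fun x => ε • x)).map (innerFamily b))
      (by simp [Measure.map_const, Measure.map_dirac])
      (fun k => (map_smul_innerFamily_conv a (hsq k)).symm)
      (fun k => (map_smul_innerFamily_conv b ((add_comm _ _).trans (hsq k))).symm)
      hF.1.continuous hFB (c := (C + D) * ε ^ 3)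
      (fun p => by
        rw [integral_map_smul_innerFamily _ _ hF.1.continuous,
          integral_map_smul_innerFamily _ _ hF.1.continuous]
        exact hstep ε hε0.le p) (m + 1) 0
    rw [integral_map_smul_innerFamily _ _ hF.1.continuous,
      integral_map_smul_innerFamily _ _ hF.1.continuous] at h
    have h1 : √((m + 1 : ℕ) : ℝ) * ε = 1 := by
      rw [hε]
      push_cast
      exact mul_inv_cancel₀ (by positivity)
    have h2 : ((m + 1 : ℕ) : ℝ) * ((C + D) * ε ^ 3) = (C + D) * ε := by
      have : ((m : ℝ) + 1) * ε ^ 2 = 1 := by rw [hε2]; exact mul_inv_cancel₀ (by positivity)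
      push_cast
      linear_combination (C + D) * ε * this
    simpa only [h1, h2, one_smul, zero_add] using h
  have hlim : Filter.Tendsto (fun m : ℕ => ∫ x, F (innerFamily a x) ∂(stdGaussian E)
      + (C + D) * (√(m + 1))⁻¹) Filter.atTop
      (nhds (∫ x, F (innerFamily a x) ∂(stdGaussian E) + (C + D) * 0)) := by
    refine tendsto_const_nhds.add (tendsto_const_nhds.mul ?_)
    refine tendsto_inv_atTop_zero.comp (Real.tendsto_sqrt_atTop.comp ?_)
    exact Filter.tendsto_atTop_add_const_right _ _ tendsto_natCast_atTop_atTop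
  simpa using ge_of_tendsto' hlim hm

theorem measurableSet_exists_lt_inner (a : W × U → E) (lam : W → U → ℝ) :
    MeasurableSet {x : E | ∀ w, ∃ u, lam w u < ⟪a (w, u), x⟫} := by
  have : {x : E | ∀ w, ∃ u, lam w u < ⟪a (w, u), x⟫}
      = ⋂ w, ⋃ u, {x : E | lam w u < ⟪a (w, u), x⟫} := by
    ext; simp
  rw [this]
  exact .iInter fun w => .iUnion fun u => measurableSet_lt (by fun_prop) (by fun_prop)

theorem tendsto_integral_gordonTest (a : W × U → E) (lam : W → U → ℝ) :
    Filter.Tendsto (fun k : ℕ =>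
        ∫ x, gordonTest (k + 1) lam (innerFamily a x) ∂(stdGaussian E)) Filter.atTop
      (nhds ((stdGaussian E).real {x | ∀ w, ∃ u, lam w u < ⟪a (w, u), x⟫})) := by
  rw [← integral_indicator_one (measurableSet_exists_lt_inner a lam)]
  refine tendsto_integral_of_dominated_convergence (fun _ => 1) (fun k => ?_)
    (integrable_const _) (fun k => .of_forall fun x => ?_) (.of_forall fun x => ?_)
  · exact ((hasBoundedDerivs_gordonTest (by positivity) lam).1.continuous.comp
      (innerFamily a).continuous).aestronglyMeasurable
  · obtain ⟨h0, h1⟩ := gordonTest_mem_Icc (k + 1) lam (innerFamily a x)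
    rwa [Real.norm_of_nonneg h0]
  · convert! tendsto_gordonTest lam (innerFamily a x) using 2

/-- **Gordon's comparison inequality** for finitely indexed centered Gaussian processes. -/
theorem gordon_comparison {a : W × U → E} {b : W × U → E'}
    (heq : ∀ i j, i.1 = j.1 → ⟪a i, a j⟫ = ⟪b i, b j⟫)
    (hle : ∀ i j, i.1 ≠ j.1 → ⟪b i, b j⟫ ≤ ⟪a i, a j⟫) (lam : W → U → ℝ) :
    stdGaussian E {x | ∃ w, ∀ u, ⟪a (w, u), x⟫ ≤ lam w u}
      ≤ stdGaussian E' {y | ∃ w, ∀ u, ⟪b (w, u), y⟫ ≤ lam w u} := by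
  have h := le_of_tendsto_of_tendsto' (tendsto_integral_gordonTest b lam)
    (tendsto_integral_gordonTest a lam) fun k =>
      integral_gordonTest_le heq hle (by positivity) lam
  have ha : {x : E | ∃ w, ∀ u, ⟪a (w, u), x⟫ ≤ lam w u}
      = {x | ∀ w, ∃ u, lam w u < ⟪a (w, u), x⟫}ᶜ := by ext; simp
  have hb : {x : E' | ∃ w, ∀ u, ⟪b (w, u), x⟫ ≤ lam w u}
      = {x | ∀ w, ∃ u, lam w u < ⟪b (w, u), x⟫}ᶜ := by ext; simp
  rw [ha, hb, prob_compl_eq_one_sub (measurableSet_exists_lt_inner a lam),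
    prob_compl_eq_one_sub (measurableSet_exists_lt_inner b lam)]
  refine tsub_le_tsub_left ?_ _
  exact (ENNReal.toReal_le_toReal (measure_ne_top _ _) (measure_ne_top _ _)).1 h

end Gordon

section FiniteMinMax

open scoped RealInnerProductSpace

variable {n N : ℕ}

instance : IsProbabilityMeasure (PG n N) := by unfold PG; infer_instance

instance : IsProbabilityMeasure (Pgh n N) := by unfold Pgh; infer_instance

theorem measurePreserving_PG_prod :
    MeasurePreserving (fun (p : (Fin n → Fin N → ℝ) × ℝ) (k : (Fin n × Fin N) ⊕ Unit) =>
        Sum.elim (fun ij => p.1 ij.1 ij.2) (fun _ => p.2) k)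
      ((PG n N).prod (gaussianReal 0 1)) (Measure.pi fun _ => gaussianReal 0 1) := by
  have hm : Measurable (fun (p : (Fin n → Fin N → ℝ) × ℝ) (k : (Fin n × Fin N) ⊕ Unit) =>
      Sum.elim (fun ij => p.1 ij.1 ij.2) (fun _ => p.2) k) := by
    refine measurable_pi_iff.2 ?_
    rintro (ij | _) <;> simp only [Sum.elim_inl, Sum.elim_inr] <;> fun_prop
  refine ⟨hm, (Measure.pi_eq fun s hs => ?_).symm⟩
  rw [Measure.map_apply hm (.univ_pi hs)]
  have : (fun (p : (Fin n → Fin N → ℝ) × ℝ) (k : (Fin n × Fin N) ⊕ Unit) =>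
      Sum.elim (fun ij => p.1 ij.1 ij.2) (fun _ => p.2) k) ⁻¹' Set.univ.pi s
      = (Set.univ.pi fun i => Set.univ.pi fun j => s (.inl (i, j))) ×ˢ s (.inr ()) := by
    ext p
    simp only [Set.mem_preimage, Set.mem_univ_pi, Sum.forall, Sum.elim_inl, Sum.elim_inr,
      Prod.forall, Set.mem_prod]
    exact and_congr_right fun _ => ⟨fun h => h (), fun h _ => h⟩
  rw [this, Measure.prod_prod, PG, Measure.pi_pi]
  simp_rw [Measure.pi_pi]
  simp [Fintype.prod_prod_type]

theorem measurePreserving_Pgh :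
    MeasurePreserving (fun (p : (Fin N → ℝ) × (Fin n → ℝ)) (k : Fin N ⊕ Fin n) =>
        Sum.elim p.1 p.2 k) (Pgh n N) (Measure.pi fun _ => gaussianReal 0 1) := by
  have hm : Measurable (fun (p : (Fin N → ℝ) × (Fin n → ℝ)) (k : Fin N ⊕ Fin n) =>
      Sum.elim p.1 p.2 k) := by
    refine measurable_pi_iff.2 ?_
    rintro (i | j) <;> simp only [Sum.elim_inl, Sum.elim_inr] <;> fun_prop
  refine ⟨hm, (Measure.pi_eq fun s hs => ?_).symm⟩
  rw [Measure.map_apply hm (.univ_pi hs)]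
  have : (fun (p : (Fin N → ℝ) × (Fin n → ℝ)) (k : Fin N ⊕ Fin n) =>
      Sum.elim p.1 p.2 k) ⁻¹' Set.univ.pi s
      = (Set.univ.pi fun i => s (.inl i)) ×ˢ (Set.univ.pi fun i => s (.inr i)) := by
    ext p
    simp
  rw [this, Pgh, Measure.prod_prod, Measure.pi_pi, Measure.pi_pi]
  simp

theorem measurePreserving_toLp_pi_gaussianReal {ι : Type*} [Fintype ι] :
    MeasurePreserving (WithLp.toLp 2 : (ι → ℝ) → EuclideanSpace ℝ ι)
      (Measure.pi fun _ => gaussianReal 0 1) (stdGaussian (EuclideanSpace ℝ ι)) :=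
  ⟨by fun_prop, map_pi_eq_stdGaussian⟩

theorem one_le_two_mul_gaussianReal_Iic : 1 ≤ 2 * gaussianReal 0 1 (Set.Iic 0) := by
  have h : gaussianReal 0 1 (Set.Ici 0) = gaussianReal 0 1 (Set.Iic 0) := by
    have h1 : (gaussianReal 0 1).map (fun x => -x) = gaussianReal 0 1 := by
      simpa using gaussianReal_map_neg (μ := 0) (v := 1)
    conv_lhs => rw [← h1]
    rw [Measure.map_apply (by fun_prop) measurableSet_Ici]
    congr 1
    ext x
    simp
  calc (1 : ℝ≥0∞) = gaussianReal 0 1 Set.univ := measure_univ.symm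
    _ ≤ gaussianReal 0 1 (Set.Iic 0) + gaussianReal 0 1 (Set.Ici 0) := by
      rw [← Set.Iic_union_Ici (a := (0 : ℝ))]
      exact measure_union_le _ _
    _ = _ := by rw [h, two_mul]

theorem l2_mul_self {k : ℕ} (x : Fin k → ℝ) : l2 x * l2 x = ∑ i, x i * x i := by
  rw [l2, Real.mul_self_sqrt (Finset.sum_nonneg fun i _ => sq_nonneg _)]
  simp_rw [sq]

theorem l2_nonneg {k : ℕ} (x : Fin k → ℝ) : 0 ≤ l2 x := Real.sqrt_nonneg _

theorem sum_mul_le_l2_mul_l2 {k : ℕ} (x y : Fin k → ℝ) : ∑ i, x i * y i ≤ l2 x * l2 y :=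
  Real.sum_mul_le_sqrt_mul_sqrt _ _ _

variable {W U : Type*} [Fintype W] [Fintype U]

/-- The bilinear form `uᵀ G w`. -/
def bilin (w : Fin N → ℝ) (u : Fin n → ℝ) (G : Fin n → Fin N → ℝ) : ℝ :=
  ∑ i, u i * ∑ j, G i j * w j

/-- The decoupled linear form `‖u‖ gᵀ w + ‖w‖ hᵀ u`. -/
def decoupled (w : Fin N → ℝ) (u : Fin n → ℝ) (gh : (Fin N → ℝ) × (Fin n → ℝ)) : ℝ :=
  l2 u * (∑ j, gh.1 j * w j) + l2 w * (∑ i, gh.2 i * u i)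

theorem PG_exists_forall_bilin_le (w : W → Fin N → ℝ) (u : U → Fin n → ℝ) (lam : W → U → ℝ) :
    PG n N {G | ∃ k, ∀ l, bilin (w k) (u l) G ≤ lam k l}
      ≤ 2 * Pgh n N {gh | ∃ k, ∀ l, decoupled (w k) (u l) gh ≤ lam k l} := by
  set a : W × U → EuclideanSpace ℝ ((Fin n × Fin N) ⊕ Unit) := fun p => WithLp.toLp 2
    (Sum.elim (fun ij => u p.2 ij.1 * w p.1 ij.2) (fun _ => l2 (w p.1) * l2 (u p.2))) with ha
  set b : W × U → EuclideanSpace ℝ (Fin N ⊕ Fin n) := fun p => WithLp.toLp 2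
    (Sum.elim (fun j => l2 (u p.2) * w p.1 j) (fun i => l2 (w p.1) * u p.2 i)) with hb
  have haa : ∀ p q, ⟪a p, a q⟫ = (∑ i, u p.2 i * u q.2 i) * (∑ j, w p.1 j * w q.1 j)
      + l2 (w p.1) * l2 (w q.1) * (l2 (u p.2) * l2 (u q.2)) := by
    intro p q
    simp only [ha, PiLp.inner_apply, Fintype.sum_sum_type, Sum.elim_inl, Sum.elim_inr,
      Fintype.sum_prod_type, Finset.sum_mul_sum, RCLike.inner_apply, conj_trivial]
    congr 1
    · refine Finset.sum_congr rfl fun i _ => Finset.sum_congr rfl fun j _ => ?_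
      ring
    · simp
      ring
  have hbb : ∀ p q, ⟪b p, b q⟫ = l2 (u p.2) * l2 (u q.2) * (∑ j, w p.1 j * w q.1 j)
      + l2 (w p.1) * l2 (w q.1) * (∑ i, u p.2 i * u q.2 i) := by
    intro p q
    simp only [hb, PiLp.inner_apply, Fintype.sum_sum_type, Sum.elim_inl, Sum.elim_inr,
      Finset.mul_sum, RCLike.inner_apply, conj_trivial]
    congr 1 <;> refine Finset.sum_congr rfl fun i _ => ?_ <;> ring
  have hG := gordon_comparison (a := a) (b := b)
    (fun p q hpq => by
      rw [haa, hbb, hpq, l2_mul_self]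
      ring)
    (fun p q _ => by
      rw [haa, hbb]
      nlinarith [mul_nonneg (sub_nonneg.2 (sum_mul_le_l2_mul_l2 (w p.1) (w q.1)))
        (sub_nonneg.2 (sum_mul_le_l2_mul_l2 (u p.2) (u q.2)))]) lam
  set A := {G : Fin n → Fin N → ℝ | ∃ k, ∀ l, bilin (w k) (u l) G ≤ lam k l}
  have hA : (PG n N).prod (gaussianReal 0 1) (A ×ˢ Set.Iic 0)
      ≤ stdGaussian _ {x | ∃ k, ∀ l, ⟪a (k, l), x⟫ ≤ lam k l} := by
    have hmp := measurePreserving_toLp_pi_gaussianReal.comp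
      (measurePreserving_PG_prod (n := n) (N := N))
    rw [← hmp.map_eq]
    refine (measure_mono ?_).trans (Measure.le_map_apply hmp.measurable.aemeasurable _)
    rintro ⟨G, z⟩ ⟨⟨k, hk⟩, hz⟩
    refine ⟨k, fun l => le_trans ?_ (hk l)⟩
    have e : ⟪a (k, l), WithLp.toLp 2 fun κ : (Fin n × Fin N) ⊕ Unit =>
        Sum.elim (fun ij => G ij.1 ij.2) (fun _ => z) κ⟫
        = bilin (w k) (u l) G + l2 (w k) * l2 (u l) * z := by
      simp only [ha, PiLp.inner_apply, Fintype.sum_sum_type, Sum.elim_inl, Sum.elim_inr,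
        Fintype.sum_prod_type, RCLike.inner_apply, conj_trivial, bilin, Finset.mul_sum]
      congr 1
      · refine Finset.sum_congr rfl fun i _ => Finset.sum_congr rfl fun j _ => ?_
        ring
      · simp
        ring
    have := mul_nonpos_of_nonneg_of_nonpos
      (mul_nonneg (l2_nonneg (w k)) (l2_nonneg (u l))) (Set.mem_Iic.1 hz)
    exact e.trans_le (by linarith)
  have hB : stdGaussian _ {y | ∃ k, ∀ l, ⟪b (k, l), y⟫ ≤ lam k l}
      = Pgh n N {gh | ∃ k, ∀ l, decoupled (w k) (u l) gh ≤ lam k l} := by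
    have hmp := measurePreserving_toLp_pi_gaussianReal.comp
      (measurePreserving_Pgh (n := n) (N := N))
    have hms : MeasurableSet {y | ∃ k, ∀ l, ⟪b (k, l), y⟫ ≤ lam k l} := by
      have : {y | ∃ k, ∀ l, ⟪b (k, l), y⟫ ≤ lam k l}
          = ⋃ k, ⋂ l, {y | ⟪b (k, l), y⟫ ≤ lam k l} := by ext; simp
      rw [this]
      exact .iUnion fun k => .iInter fun l => measurableSet_le (by fun_prop) (by fun_prop)
    rw [← hmp.measure_preimage hms.nullMeasurableSet]
    congr 1
    ext ⟨g, h⟩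
    have e : ∀ k l, ⟪b (k, l), WithLp.toLp 2 fun κ : Fin N ⊕ Fin n => Sum.elim g h κ⟫
        = decoupled (w k) (u l) (g, h) := by
      intro k l
      simp only [hb, PiLp.inner_apply, Fintype.sum_sum_type, Sum.elim_inl, Sum.elim_inr,
        RCLike.inner_apply, conj_trivial, decoupled, Finset.mul_sum]
      congr 1 <;> refine Finset.sum_congr rfl fun i _ => ?_ <;> ring
    simp [e]
  calc PG n N A = PG n N A * 1 := (mul_one _).symm
    _ ≤ PG n N A * (2 * gaussianReal 0 1 (Set.Iic 0)) := by
      gcongr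
      exact one_le_two_mul_gaussianReal_Iic
    _ = 2 * (PG n N).prod (gaussianReal 0 1) (A ×ˢ Set.Iic 0) := by
      rw [Measure.prod_prod]
      ring
    _ ≤ _ := by
      rw [← hB]
      gcongr
      exact hA.trans hG

end FiniteMinMax

section CompactMinMax

open Filter Topology TopologicalSpace

section Deterministic

variable {X Y : Type*} [TopologicalSpace X] [TopologicalSpace Y]
  [CompactSpace Y] {g : X → Y → ℝ}

theorem bddAbove_range_of_continuous (hg : Continuous fun p : X × Y => g p.1 p.2) (x : X) :
    BddAbove (Set.range (g x)) :=
  (isCompact_range (hg.comp (by fun_prop : Continuous fun y : Y => (x, y)))).bddAbove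

theorem exists_denseSeq_le_of_iInf_iSup_lt [SeparableSpace X] [Nonempty X]
    (hg : Continuous fun p : X × Y => g p.1 p.2) {t : ℝ} (h : ⨅ x, ⨆ y, g x y < t) :
    ∃ k, ∀ y, g (denseSeq X k) y ≤ t := by
  obtain ⟨x, hx⟩ := exists_lt_of_ciInf_lt h
  have h1 : ∀ y ∈ (Set.univ : Set Y), ∀ᶠ z : X × Y in 𝓝 (x, y), g z.1 z.2 < t := fun y _ =>
    hg.continuousAt.eventually_lt continuousAt_const
      ((le_ciSup (bddAbove_range_of_continuous hg x) y).trans_lt hx)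
  have h2 : ∀ᶠ x' in 𝓝 x, ∀ y ∈ (Set.univ : Set Y), g x' y < t :=
    isCompact_univ.eventually_forall_of_forall_eventually h1
  obtain ⟨k, hk⟩ := (denseRange_denseSeq X).exists_mem_open isOpen_interior
    ⟨x, mem_interior_iff_mem_nhds.2 h2⟩
  exact ⟨k, fun y => (interior_subset hk y (Set.mem_univ y)).le⟩

theorem bddBelow_range_iSup [CompactSpace X] [Nonempty Y]
    (hg : Continuous fun p : X × Y => g p.1 p.2) : BddBelow (Set.range fun x => ⨆ y, g x y) := by
  obtain ⟨B, hB⟩ := (isCompact_range hg).bddBelow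
  obtain ⟨y₀⟩ := ‹Nonempty Y›
  refine ⟨B, ?_⟩
  rintro _ ⟨x, rfl⟩
  exact (hB ⟨(x, y₀), rfl⟩).trans (le_ciSup (bddAbove_range_of_continuous hg x) y₀)

theorem iInf_iSup_le_of_forall_denseSeq_le [CompactSpace X] [SeparableSpace Y] [Nonempty Y]
    (hg : Continuous fun p : X × Y => g p.1 p.2) {t : ℝ} {x : X}
    (h : ∀ l, g x (denseSeq Y l) ≤ t) : ⨅ x, ⨆ y, g x y ≤ t :=
  (ciInf_le (bddBelow_range_iSup hg) x).trans <| ciSup_le fun y =>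
    isClosed_property (denseRange_denseSeq Y)
      (isClosed_le (hg.comp (by fun_prop : Continuous fun y : Y => (x, y))) continuous_const) h y

theorem neg_iInf_iSup_neg_le [CompactSpace X] [Nonempty X] [Nonempty Y]
    (hg : Continuous fun p : X × Y => g p.1 p.2) :
    -(⨅ y, ⨆ x, -g x y) ≤ ⨅ x, ⨆ y, g x y := by
  have hg' : Continuous fun p : Y × X => -g p.2 p.1 := (hg.comp continuous_swap).neg
  refine le_ciInf fun x => neg_le.1 (le_ciInf fun y => ?_)
  exact (neg_le_neg (le_ciSup (bddAbove_range_of_continuous hg x) y)).trans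
    (le_ciSup (bddAbove_range_of_continuous (g := fun y x => -g x y) hg' y) x)

theorem iInf_iSup_neg_le_of_saddle [CompactSpace X] [Nonempty X] [Nonempty Y]
    (hg : Continuous fun p : X × Y => g p.1 p.2) {a : X} {b : Y} (h : ∀ x y, g a y ≤ g x b) :
    ⨅ y, ⨆ x, -g x y ≤ -(⨅ x, ⨆ y, g x y) := by
  have hg' : Continuous fun p : Y × X => -g p.2 p.1 := (hg.comp continuous_swap).neg
  have h1 : ⨅ x, ⨆ y, g x y ≤ g a b :=
    (ciInf_le (bddBelow_range_iSup hg) a).trans (ciSup_le fun y => h a y)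
  have h2 : ⨅ y, ⨆ x, -g x y ≤ -g a b :=
    (ciInf_le (bddBelow_range_iSup (g := fun y x => -g x y) hg') b).trans
      (ciSup_le fun x => neg_le_neg (h x b))
  exact h2.trans (neg_le_neg h1)

end Deterministic

section Limits

variable {Ω Ω' : Type*} [MeasurableSpace Ω] [MeasurableSpace Ω'] {μ : Measure Ω} {ν : Measure Ω'}
  [IsFiniteMeasure ν]

theorem measure_exists_forall_nat_le {P : ℕ → ℕ → Ω → Prop} {R : ℕ → ℕ → Ω' → Prop}
    (hR : ∀ k l, MeasurableSet {ω | R k l ω}) {c : ℝ≥0∞} (hc : c ≠ ∞)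
    (h : ∀ K L : ℕ, μ {ω | ∃ k : Fin K, ∀ l : Fin L, P k l ω}
      ≤ c * ν {ω | ∃ k : Fin K, ∀ l : Fin L, R k l ω}) :
    μ {ω | ∃ k, ∀ l, P k l ω} ≤ c * ν {ω | ∃ k, ∀ l, R k l ω} := by
  have h1 : ∀ K : ℕ, μ {ω | ∃ k : Fin K, ∀ l, P k l ω} ≤ c * ν {ω | ∃ k : Fin K, ∀ l, R k l ω} := by
    intro K
    have hlim : Tendsto (fun L : ℕ => ν {ω | ∃ k : Fin K, ∀ l : Fin L, R k l ω}) atTop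
        (𝓝 (ν (⋂ L : ℕ, {ω | ∃ k : Fin K, ∀ l : Fin L, R k l ω}))) := by
      refine tendsto_measure_iInter_atTop (fun L => ?_) (fun L L' hL ω => ?_)
        ⟨0, measure_ne_top _ _⟩
      · have : {ω | ∃ k : Fin K, ∀ l : Fin L, R k l ω}
            = ⋃ k : Fin K, ⋂ l : Fin L, {ω | R k l ω} := by ext; simp
        rw [this]
        exact (MeasurableSet.iUnion fun k : Fin K =>
          .iInter fun l : Fin L => hR k l).nullMeasurableSet
      · rintro ⟨k, hk⟩
        exact ⟨k, fun l => hk ⟨l, l.2.trans_le hL⟩⟩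
    have hsub : (⋂ L : ℕ, {ω | ∃ k : Fin K, ∀ l : Fin L, R k l ω})
        ⊆ {ω | ∃ k : Fin K, ∀ l, R k l ω} := by
      intro ω hω
      by_contra hne
      have hne' : ∀ k : Fin K, ∃ l, ¬ R k l ω := by simpa using hne
      choose l hl using hne'
      obtain ⟨k, hk⟩ := Set.mem_iInter.1 hω (Finset.univ.sup l + 1)
      exact hl k (hk ⟨l k, Nat.lt_succ_of_le (Finset.le_sup (Finset.mem_univ k))⟩)
    refine (ge_of_tendsto' (ENNReal.Tendsto.const_mul hlim (.inr hc)) fun L => ?_).trans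
      (mul_le_mul_right (measure_mono hsub) c)
    refine (measure_mono ?_).trans (h K L)
    rintro ω ⟨k, hk⟩
    exact ⟨k, fun l => hk l⟩
  have hU : {ω | ∃ k, ∀ l, P k l ω} = ⋃ K : ℕ, {ω | ∃ k : Fin K, ∀ l, P k l ω} := by
    ext ω
    simp only [Set.mem_ofPred_eq, Set.mem_iUnion]
    exact ⟨fun ⟨k, hk⟩ => ⟨k + 1, ⟨k, k.lt_succ_self⟩, hk⟩, fun ⟨_, k, hk⟩ => ⟨k, hk⟩⟩
  have hmono : Monotone fun K : ℕ => {ω | ∃ k : Fin K, ∀ l, P k l ω} := by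
    rintro K K' hK ω ⟨k, hk⟩
    exact ⟨⟨k, k.2.trans_le hK⟩, hk⟩
  rw [hU, hmono.measure_iUnion]
  refine iSup_le fun K => (h1 K).trans (mul_le_mul_right (measure_mono ?_) c)
  rintro ω ⟨k, hk⟩
  exact ⟨k, hk⟩

end Limits

variable {n N : ℕ}

theorem measurable_decoupled (w : Fin N → ℝ) (u : Fin n → ℝ) : Measurable (decoupled w u) := by
  unfold decoupled
  fun_prop

theorem Cstar_eq_iInf_iSup (Sw : Set (Fin N → ℝ)) (Su : Set (Fin n → ℝ))
    (Q : (Fin N → ℝ) → (Fin n → ℝ) → ℝ) (G : Fin n → Fin N → ℝ) :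
    Cstar Sw Su Q G = ⨅ w : Sw, ⨆ u : Su, bilin w.1 u.1 G + Q w u := by
  simp only [Cstar, sInf_image', sSup_image', bilin]

theorem Lstar_eq_iInf_iSup (Sw : Set (Fin N → ℝ)) (Su : Set (Fin n → ℝ))
    (Q : (Fin N → ℝ) → (Fin n → ℝ) → ℝ) (gh : (Fin N → ℝ) × (Fin n → ℝ)) :
    Lstar Sw Su Q gh.1 gh.2 = ⨅ w : Sw, ⨆ u : Su, decoupled w.1 u.1 gh + Q w u := by
  simp only [Lstar, sInf_image', sSup_image', decoupled]

theorem continuous_bilin (G : Fin n → Fin N → ℝ) :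
    Continuous fun p : (Fin N → ℝ) × (Fin n → ℝ) => bilin p.1 p.2 G := by
  unfold bilin
  fun_prop

theorem continuous_decoupled (gh : (Fin N → ℝ) × (Fin n → ℝ)) :
    Continuous fun p : (Fin N → ℝ) × (Fin n → ℝ) => decoupled p.1 p.2 gh := by
  unfold decoupled l2
  fun_prop

theorem PG_Cstar_le {Sw : Set (Fin N → ℝ)} {Su : Set (Fin n → ℝ)}
    (hSwc : IsCompact Sw) (hSuc : IsCompact Su) (hSwne : Sw.Nonempty) (hSune : Su.Nonempty)
    {Q : (Fin N → ℝ) → (Fin n → ℝ) → ℝ}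
    (hQ : ContinuousOn (fun p : (Fin N → ℝ) × (Fin n → ℝ) => Q p.1 p.2) (Sw ×ˢ Su)) (t : ℝ) :
    PG n N {G | Cstar Sw Su Q G ≤ t} ≤ 2 * Pgh n N {gh | Lstar Sw Su Q gh.1 gh.2 ≤ t} := by
  have := isCompact_iff_compactSpace.1 hSwc
  have := isCompact_iff_compactSpace.1 hSuc
  have := hSwne.to_subtype
  have := hSune.to_subtype
  have hQ' : Continuous fun p : Sw × Su => Q p.1 p.2 :=
    hQ.comp_continuous (f := fun p : Sw × Su => ((p.1 : Fin N → ℝ), (p.2 : Fin n → ℝ)))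
      (by fun_prop) fun p => ⟨p.1.2, p.2.2⟩
  have hC : ∀ G, Continuous fun p : Sw × Su => bilin p.1.1 p.2.1 G + Q p.1 p.2 := fun G =>
    ((continuous_bilin G).comp (by fun_prop :
      Continuous fun p : Sw × Su => ((p.1 : Fin N → ℝ), (p.2 : Fin n → ℝ)))).add hQ'
  have hL : ∀ gh, Continuous fun p : Sw × Su => decoupled p.1.1 p.2.1 gh + Q p.1 p.2 := fun gh =>
    ((continuous_decoupled gh).comp (by fun_prop :
      Continuous fun p : Sw × Su => ((p.1 : Fin N → ℝ), (p.2 : Fin n → ℝ)))).add hQ'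
  set EL : ℝ → Set ((Fin N → ℝ) × (Fin n → ℝ)) := fun s => {gh | ∃ k, ∀ l,
    decoupled (denseSeq Sw k).1 (denseSeq Su l).1 gh ≤ s - Q (denseSeq Sw k) (denseSeq Su l)}
    with hEL
  have hELm : ∀ s, MeasurableSet (EL s) := fun s => by
    have : EL s = ⋃ k, ⋂ l, {gh | decoupled (denseSeq Sw k).1 (denseSeq Su l).1 gh
        ≤ s - Q (denseSeq Sw k) (denseSeq Su l)} := by ext; simp [hEL]
    rw [this]
    exact .iUnion fun k => .iInter fun l =>
      measurableSet_le (measurable_decoupled _ _) measurable_const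
  have hstep : ∀ s > t, PG n N {G | Cstar Sw Su Q G ≤ t} ≤ 2 * Pgh n N (EL s) := by
    intro s hs
    refine le_trans (measure_mono fun G hG => ?_) (measure_exists_forall_nat_le (P := fun k l G =>
        bilin (denseSeq Sw k).1 (denseSeq Su l).1 G ≤ s - Q (denseSeq Sw k) (denseSeq Su l))
      (fun k l => measurableSet_le (measurable_decoupled _ _) measurable_const) (by simp)
      fun K L => PG_exists_forall_bilin_le (fun k : Fin K => (denseSeq Sw k).1)
        (fun l : Fin L => (denseSeq Su l).1) fun k l => s - Q (denseSeq Sw k) (denseSeq Su l))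
    have hG' : Cstar Sw Su Q G < s := lt_of_le_of_lt (by simpa using hG) hs
    rw [Cstar_eq_iInf_iSup] at hG'
    obtain ⟨k, hk⟩ := exists_denseSeq_le_of_iInf_iSup_lt (hC G) hG'
    exact ⟨k, fun l => le_sub_iff_add_le.2 (hk _)⟩
  have hlim : Tendsto (fun m : ℕ => Pgh n N (EL (t + 1 / ((m : ℝ) + 1)))) atTop
      (𝓝 (Pgh n N (⋂ m : ℕ, EL (t + 1 / ((m : ℝ) + 1))))) := by
    refine tendsto_measure_iInter_atTop (fun m => (hELm _).nullMeasurableSet)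
      (fun m m' hm gh => ?_) ⟨0, measure_ne_top _ _⟩
    rintro ⟨k, hk⟩
    refine ⟨k, fun l => (hk l).trans ?_⟩
    have := Nat.one_div_le_one_div (α := ℝ) hm
    linarith
  have hsub : (⋂ m : ℕ, EL (t + 1 / ((m : ℝ) + 1))) ⊆ {gh | Lstar Sw Su Q gh.1 gh.2 ≤ t} := by
    intro gh hgh
    have h1 : ∀ m : ℕ, Lstar Sw Su Q gh.1 gh.2 ≤ t + 1 / ((m : ℝ) + 1) := by
      intro m
      obtain ⟨k, hk⟩ := Set.mem_iInter.1 hgh m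
      rw [Lstar_eq_iInf_iSup]
      exact iInf_iSup_le_of_forall_denseSeq_le (hL gh) (x := denseSeq Sw k)
        fun l => le_sub_iff_add_le.1 (hk l)
    have h2 := ge_of_tendsto' (tendsto_one_div_add_atTop_nhds_zero_nat.const_add t) h1
    simpa using h2
  refine (ge_of_tendsto' (ENNReal.Tendsto.const_mul hlim (.inr (by simp))) fun m =>
    hstep _ ?_).trans (mul_le_mul_right (measure_mono hsub) 2)
  have : (0 : ℝ) < 1 / ((m : ℝ) + 1) := by positivity
  linarith

end CompactMinMax

section ConvexConcave

variable {n N : ℕ}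

theorem measurePreserving_neg_gaussianReal :
    MeasurePreserving (fun x : ℝ => -x) (gaussianReal 0 1) (gaussianReal 0 1) :=
  ⟨by fun_prop, by simpa using gaussianReal_map_neg (μ := 0) (v := 1)⟩

theorem measurePreserving_neg_transpose :
    MeasurePreserving (fun (G : Fin n → Fin N → ℝ) (j : Fin N) (i : Fin n) => -G i j)
      (PG n N) (PG N n) := by
  have key : ∀ {k l : ℕ} {μ : Measure (Fin k → Fin l → ℝ)},
      μ.map (MeasurableEquiv.curry (Fin k) (Fin l) ℝ).symm = Measure.pi (fun _ => gaussianReal 0 1)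
        → μ = PG k l := by
    intro k l μ hμ
    have hP : (PG k l).map (MeasurableEquiv.curry (Fin k) (Fin l) ℝ).symm
        = Measure.pi (fun _ => gaussianReal 0 1) := by
      refine (Measure.pi_eq fun s hs => ?_).symm
      rw [MeasurableEquiv.map_apply]
      have : (MeasurableEquiv.curry (Fin k) (Fin l) ℝ).symm ⁻¹' Set.univ.pi s
          = Set.univ.pi fun i => Set.univ.pi fun j => s (i, j) := by
        ext G
        simp [MeasurableEquiv.curry, Function.uncurry]
      rw [this, PG, Measure.pi_pi]
      simp_rw [Measure.pi_pi]
      rw [Fintype.prod_prod_type]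
    exact (MeasurableEquiv.map_measurableEquiv_injective _) (hμ.trans hP.symm)
  have hm : Measurable (fun (G : Fin n → Fin N → ℝ) (j : Fin N) (i : Fin n) => -G i j) := by
    fun_prop
  refine ⟨hm, key ?_⟩
  rw [Measure.map_map (by fun_prop) hm]
  refine (Measure.pi_eq fun s hs => ?_).symm
  rw [Measure.map_apply ((MeasurableEquiv.measurable _).comp hm) (.univ_pi hs)]
  have : ((MeasurableEquiv.curry (Fin N) (Fin n) ℝ).symm ∘
        fun (G : Fin n → Fin N → ℝ) (j : Fin N) (i : Fin n) => -G i j) ⁻¹' Set.univ.pi s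
      = Set.univ.pi fun i => Set.univ.pi fun j => (fun x : ℝ => -x) ⁻¹' s (j, i) := by
    ext G
    simp only [Set.mem_preimage, Set.mem_univ_pi, Prod.forall]
    exact forall_comm
  rw [this, PG, Measure.pi_pi]
  simp_rw [Measure.pi_pi, measurePreserving_neg_gaussianReal.measure_preimage
    (hs _).nullMeasurableSet]
  rw [Finset.prod_comm, Fintype.prod_prod_type]

theorem measurePreserving_neg_swap :
    MeasurePreserving (fun gh : (Fin n → ℝ) × (Fin N → ℝ) => (-gh.2, -gh.1))
      (Pgh N n) (Pgh n N) := by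
  have h : ∀ k : ℕ, MeasurePreserving (fun x : Fin k → ℝ => -x)
      (Measure.pi fun _ => gaussianReal 0 1) (Measure.pi fun _ => gaussianReal 0 1) := fun k =>
    measurePreserving_pi _ _ fun _ => measurePreserving_neg_gaussianReal
  exact ((h N).prod (h n)).comp Measure.measurePreserving_swap

theorem bilin_eq_dotProduct (w : Fin N → ℝ) (u : Fin n → ℝ) (G : Fin n → Fin N → ℝ) :
    bilin w u G = dotProduct u (Matrix.mulVec (Matrix.of G) w) := rfl

theorem convexOn_bilin {Sw : Set (Fin N → ℝ)} (h : Convex ℝ Sw) (u : Fin n → ℝ)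
    (G : Fin n → Fin N → ℝ) : ConvexOn ℝ Sw fun w => bilin w u G :=
  ⟨h, fun x _ y _ a b _ _ _ => le_of_eq (by
    simp [bilin_eq_dotProduct, Matrix.mulVec_add, Matrix.mulVec_smul])⟩

theorem concaveOn_bilin {Su : Set (Fin n → ℝ)} (h : Convex ℝ Su) (w : Fin N → ℝ)
    (G : Fin n → Fin N → ℝ) : ConcaveOn ℝ Su fun u => bilin w u G :=
  ⟨h, fun x _ y _ a b _ _ _ => le_of_eq (by simp [bilin_eq_dotProduct, add_dotProduct])⟩

theorem bilin_neg_transpose (w : Fin N → ℝ) (u : Fin n → ℝ) (G : Fin n → Fin N → ℝ) :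
    bilin u w (fun j i => -G i j) = -bilin w u G := by
  simp only [bilin, Finset.mul_sum, ← Finset.sum_neg_distrib]
  rw [Finset.sum_comm]
  refine Finset.sum_congr rfl fun i _ => Finset.sum_congr rfl fun j _ => ?_
  ring

theorem decoupled_neg_swap (w : Fin N → ℝ) (u : Fin n → ℝ) (gh : (Fin n → ℝ) × (Fin N → ℝ)) :
    decoupled w u (-gh.2, -gh.1) = -decoupled u w gh := by
  simp only [decoupled, Pi.neg_apply, neg_mul, Finset.sum_neg_distrib]
  ring

theorem PG_le_Cstar {Sw : Set (Fin N → ℝ)} {Su : Set (Fin n → ℝ)}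
    (hSwc : IsCompact Sw) (hSuc : IsCompact Su) (hSwne : Sw.Nonempty) (hSune : Su.Nonempty)
    {Q : (Fin N → ℝ) → (Fin n → ℝ) → ℝ}
    (hQ : ContinuousOn (fun p : (Fin N → ℝ) × (Fin n → ℝ) => Q p.1 p.2) (Sw ×ˢ Su))
    (hSw : Convex ℝ Sw) (hSu : Convex ℝ Su) (hQw : ∀ u ∈ Su, ConvexOn ℝ Sw fun w => Q w u)
    (hQu : ∀ w ∈ Sw, ConcaveOn ℝ Su fun u => Q w u) (t : ℝ) :
    PG n N {G | t ≤ Cstar Sw Su Q G} ≤ 2 * Pgh n N {gh | t ≤ Lstar Sw Su Q gh.1 gh.2} := by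
  have := isCompact_iff_compactSpace.1 hSwc
  have := isCompact_iff_compactSpace.1 hSuc
  have := hSwne.to_subtype
  have := hSune.to_subtype
  set Q' : (Fin n → ℝ) → (Fin N → ℝ) → ℝ := fun u w => -Q w u with hQ'def
  have hQ' : ContinuousOn (fun p : (Fin n → ℝ) × (Fin N → ℝ) => Q' p.1 p.2) (Su ×ˢ Sw) :=
    (hQ.comp continuous_swap.continuousOn fun p hp => ⟨hp.2, hp.1⟩).neg
  have hCon : ∀ G, ContinuousOn (fun p : (Fin N → ℝ) × (Fin n → ℝ) => bilin p.1 p.2 G + Q p.1 p.2)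
      (Sw ×ˢ Su) := fun G => (continuous_bilin G).continuousOn.add hQ
  have hval : Continuous fun p : Sw × Su => ((p.1 : Fin N → ℝ), (p.2 : Fin n → ℝ)) := by fun_prop
  have hC : ∀ G, Continuous fun p : Sw × Su => bilin p.1.1 p.2.1 G + Q p.1 p.2 := fun G =>
    (hCon G).comp_continuous hval fun p => ⟨p.1.2, p.2.2⟩
  have hL : ∀ gh, Continuous fun p : Sw × Su => decoupled p.1.1 p.2.1 gh + Q p.1 p.2 := fun gh =>
    ((continuous_decoupled gh).continuousOn.add hQ).comp_continuous hval fun p => ⟨p.1.2, p.2.2⟩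
  have h1 : ∀ G, t ≤ Cstar Sw Su Q G → Cstar Su Sw Q' (fun j i => -G i j) ≤ -t := by
    intro G hG
    obtain ⟨a, ha, b, hb, hab⟩ := Sion.exists_isSaddlePointOn
      (f := fun w u => bilin w u G + Q w u) hSwne hSw hSwc
      (fun u hu => ((hCon G).comp (f := fun w => (w, u)) (by fun_prop)
        fun w hw => ⟨hw, hu⟩).lowerSemicontinuousOn)
      (fun u hu => ((convexOn_bilin hSw u G).add (hQw u hu)).quasiconvexOn) hSu hSune hSuc
      (fun w hw => ((hCon G).comp (f := fun u => (w, u)) (by fun_prop)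
        fun u hu => ⟨hw, hu⟩).upperSemicontinuousOn)
      (fun w hw => ((concaveOn_bilin hSu w G).add (hQu w hw)).quasiconcaveOn)
    have h := iInf_iSup_neg_le_of_saddle
      (g := fun (w : Sw) (u : Su) => bilin w.1 u.1 G + Q w u) (hC G) (a := ⟨a, ha⟩) (b := ⟨b, hb⟩)
      fun x y => hab x x.2 y y.2
    rw [Cstar_eq_iInf_iSup] at hG ⊢
    simp only [bilin_neg_transpose, hQ'def, ← neg_add]
    exact h.trans (neg_le_neg hG)
  have h2 : ∀ gh : (Fin n → ℝ) × (Fin N → ℝ), Lstar Su Sw Q' gh.1 gh.2 ≤ -t →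
      t ≤ Lstar Sw Su Q (-gh.2) (-gh.1) := by
    intro gh hgh
    have h := neg_iInf_iSup_neg_le
      (g := fun (w : Sw) (u : Su) => decoupled w.1 u.1 (-gh.2, -gh.1) + Q w u) (hL (-gh.2, -gh.1))
    rw [Lstar_eq_iInf_iSup] at hgh
    refine (le_neg.1 hgh).trans ?_
    rw [Lstar_eq_iInf_iSup Sw Su Q (-gh.2, -gh.1)]
    simpa only [decoupled_neg_swap, hQ'def, neg_add, neg_neg] using h
  calc PG n N {G | t ≤ Cstar Sw Su Q G}
      ≤ PG n N ((fun G j i => -G i j) ⁻¹' {G | Cstar Su Sw Q' G ≤ -t}) :=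
        measure_mono fun G hG => h1 G hG
    _ ≤ PG N n {G | Cstar Su Sw Q' G ≤ -t} := by
        conv_rhs => rw [← measurePreserving_neg_transpose.map_eq]
        exact Measure.le_map_apply measurePreserving_neg_transpose.measurable.aemeasurable _
    _ ≤ 2 * Pgh N n {gh | Lstar Su Sw Q' gh.1 gh.2 ≤ -t} :=
        PG_Cstar_le hSuc hSwc hSune hSwne hQ' (-t)
    _ ≤ 2 * Pgh N n ((fun gh => (-gh.2, -gh.1)) ⁻¹' {gh | t ≤ Lstar Sw Su Q gh.1 gh.2}) := by
        gcongr
        exact fun gh hgh => h2 gh hgh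
    _ ≤ 2 * Pgh n N {gh | t ≤ Lstar Sw Su Q gh.1 gh.2} := by
        gcongr
        conv_rhs => rw [← measurePreserving_neg_swap.map_eq]
        exact Measure.le_map_apply measurePreserving_neg_swap.measurable.aemeasurable _

end ConvexConcave

/-- Tight Gaussian min–max theorem (Thrampoulidis–Oymak–Hassibi). -/
theorem stmt10 (n N : ℕ)
    (Sw : Set (Fin N → ℝ)) (Su : Set (Fin n → ℝ))
    (hSwc : IsCompact Sw) (hSuc : IsCompact Su)
    (hSwne : Sw.Nonempty) (hSune : Su.Nonempty)
    (Q : (Fin N → ℝ) → (Fin n → ℝ) → ℝ)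
    (hQ : ContinuousOn (fun p : (Fin N → ℝ) × (Fin n → ℝ) => Q p.1 p.2) (Sw ×ˢ Su)) :
    (∀ t : ℝ,
      PG n N {G | Cstar Sw Su Q G ≤ t}
        ≤ 2 * Pgh n N {gh | Lstar Sw Su Q gh.1 gh.2 ≤ t}) ∧
    ((Convex ℝ Sw ∧ Convex ℝ Su ∧
      (∀ u ∈ Su, ConvexOn ℝ Sw fun w => Q w u) ∧
      (∀ w ∈ Sw, ConcaveOn ℝ Su fun u => Q w u)) →
      ∀ t : ℝ,
      PG n N {G | t ≤ Cstar Sw Su Q G}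
        ≤ 2 * Pgh n N {gh | t ≤ Lstar Sw Su Q gh.1 gh.2}) := by
  exact ⟨PG_Cstar_le hSwc hSuc hSwne hSune hQ, fun ⟨hSw, hSu, hQw, hQu⟩ =>
    PG_le_Cstar hSwc hSuc hSwne hSune hQ hSw hSu hQw hQu⟩
end
end
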